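/- There is a constant C > 0 such that for every natural number N ≥ 5 there exists a glue-restricted tile assembly system 𝒯 = (T_N, σ, 1) (an rgTAS) such that 𝒯 is directed, the N×N square S_N strictly self-assembles in 𝒯, and |T_N| ≤ C · (log₂ N)/(log₂ log₂ N). -/

import Mathlib

namespace TA

abbrev Pos : Type := ℤ × ℤ

def U2 : Finset Pos := {(0, 1), (1, 0), (0, -1), (-1, 0)}

structure Tile where
  col : Pos → ℕ
  str : Pos → ℤ

noncomputable instance : DecidableEq Tile := Classical.decEq _

/-- Interaction strength between side `u` of tile `t` and side `-u` of tile `t'`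
(diagonal glue function: glues interact only if both color and strength match). -/
def interaction (t t' : Tile) (u : Pos) : ℤ :=
  if t.col u = t'.col (-u) ∧ t.str u = t'.str (-u) then t.str u else 0

abbrev Assembly : Type := Pos → Option Tile

def adom (α : Assembly) : Set Pos := {x | α x ≠ none}

/-- Total binding strength experienced by tile `t` when placed at position `m` in `α`. -/
def bindStrength (α : Assembly) (t : Tile) (m : Pos) : ℤ :=
  ∑ u ∈ U2, (α (m + u)).elim 0 (fun t' => interaction t t' u)

/-- A tile assembly system: a finite tile set, a single seed tile (placed at the
origin), and a temperature. -/
structure TAS where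
  tiles : Finset Tile
  seedTile : Tile
  temp : ℤ
  seed_mem : seedTile ∈ tiles

def TAS.seed (𝒯 : TAS) : Assembly := fun x => if x = (0, 0) then some 𝒯.seedTile else none

/-- Tile `t` may be placed at empty position `m` of `α` if the sum of its
interaction strengths with adjacent tiles is at least the temperature
(irreversible model: negative glues count toward the sum). -/
def CanPlace (𝒯 : TAS) (α : Assembly) (m : Pos) (t : Tile) : Prop :=
  t ∈ 𝒯.tiles ∧ α m = none ∧ 𝒯.temp ≤ bindStrength α t m

def Step (𝒯 : TAS) (α β : Assembly) : Prop :=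
  ∃ m t, CanPlace 𝒯 α m t ∧ β = Function.update α m (some t)

/-- A (possibly stuttering) assembly sequence starting at the seed. -/
def AsmSeq (𝒯 : TAS) (f : ℕ → Assembly) : Prop :=
  f 0 = 𝒯.seed ∧ ∀ i, Step 𝒯 (f i) (f (i + 1)) ∨ f (i + 1) = f i

/-- `α` is the result (union) of the assembly sequence `f`. -/
def IsResult (f : ℕ → Assembly) (α : Assembly) : Prop :=
  ∀ x, (∃ i, f i x = α x ∧ f i x ≠ none) ∨ (α x = none ∧ ∀ i, f i x = none)

def Producible (𝒯 : TAS) (α : Assembly) : Prop :=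
  ∃ f, AsmSeq 𝒯 f ∧ IsResult f α

/-- No tile can be added to `α`. -/
def Stuck (𝒯 : TAS) (α : Assembly) : Prop := ∀ m t, ¬ CanPlace 𝒯 α m t

def Terminal (𝒯 : TAS) (α : Assembly) : Prop := Producible 𝒯 α ∧ Stuck 𝒯 α

/-- A TAS is directed if it has exactly one terminal assembly. -/
def DirectedTAS (𝒯 : TAS) : Prop := ∃! α, Terminal 𝒯 α

/-- `X` strictly self-assembles in `𝒯`: the domain of every terminal assembly is a
translate of `X`. -/
def StrictlySelfAssembles (𝒯 : TAS) (X : Set Pos) : Prop :=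
  ∀ α, Terminal 𝒯 α → ∃ v : Pos, adom α = (fun p => p + v) '' X

/-- Every glue strength lies in {-1,0,1}, and there is exactly one glue color of
strength `-1`. -/
def GlueRestricted (T : Finset Tile) : Prop :=
  (∀ t ∈ T, ∀ u ∈ U2, t.str u ∈ ({-1, 0, 1} : Set ℤ)) ∧
  (∃! c : ℕ, ∃ t ∈ T, ∃ u ∈ U2, t.col u = c ∧ t.str u = -1)

/-- A glue-restricted temperature-1 TAS. -/
def IsRgTAS (𝒯 : TAS) : Prop := GlueRestricted 𝒯.tiles ∧ 𝒯.temp = 1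

/-- The `N × N` square `{0,…,N-1} × {0,…,N-1}`. -/
def SN (N : ℕ) : Set Pos := {p : Pos | 0 ≤ p.1 ∧ p.1 < (N : ℤ) ∧ 0 ≤ p.2 ∧ p.2 < (N : ℤ)}

/-- Give every negative-strength glue of `t` strength `-s` instead. -/
def reStr (s : ℤ) (t : Tile) : Tile := ⟨t.col, fun u => if t.str u < 0 then -s else t.str u⟩

/-- A complete run: steps happen as long as possible, and once stuck the sequence
stutters.  A TAS "admits exactly one assembly sequence" iff `∃! f, RunSeq 𝒯 f`. -/
def RunSeq (𝒯 : TAS) (f : ℕ → Assembly) : Prop :=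
  f 0 = 𝒯.seed ∧ ∀ i, Step 𝒯 (f i) (f (i + 1)) ∨ (Stuck 𝒯 (f i) ∧ f (i + 1) = f i)

/-- `u` is an input side of position `x` in the assembly sequence `f`. -/
def InSide (f : ℕ → Assembly) (x u : Pos) : Prop :=
  ∃ i t t', f i x = none ∧ f (i + 1) x = some t ∧ f i (x + u) = some t' ∧
    0 < interaction t t' u

/-- A zig-zag TAS: temperature 2, directed, unique assembly sequence, and no tile
ever has `(0,1)` as an input side. -/
def ZigZag (𝒯 : TAS) : Prop :=
  𝒯.temp = 2 ∧ DirectedTAS 𝒯 ∧ (∃! f, RunSeq 𝒯 f) ∧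
    ∀ f, RunSeq 𝒯 f → ∀ x, ¬ InSide f x (0, 1)

def CompactZigZag (𝒯 : TAS) : Prop :=
  ZigZag 𝒯 ∧ ∀ α, Terminal 𝒯 α → ∀ x t, α x = some t → ∀ u ∈ U2, t.str u + t.str (-u) < 4

/-- `𝒮` path simulates `𝒯` at scale factor `c`: `𝒮` has a unique assembly
sequence, and there are segment indices `I` (with `c` the maximal segment length,
attained) and a map `F` from producible assemblies of `𝒮` to producible assemblies
of `𝒯` sending the result of the `j`-th segment of `𝒮`'s run to the `j`-th assembly
of `𝒯`'s run. -/
def PathSimulates (𝒮 𝒯 : TAS) (c : ℕ) : Prop :=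
  (∃! g, RunSeq 𝒮 g) ∧
  ∀ f g, RunSeq 𝒯 f → RunSeq 𝒮 g →
    ∃ I : ℕ → ℕ, I 0 = 0 ∧ StrictMono I ∧
      (∀ j, I (j + 1) - I j ≤ c) ∧ (∃ j, I (j + 1) - I j = c) ∧
      ∃ F : Assembly → Assembly,
        (∀ β, Producible 𝒮 β → Producible 𝒯 (F β)) ∧
        ∀ j, F (g (I (j + 1) - 1)) = f j

end TA

namespace TA

/-- Glues carried by the sides of the tiles of a path system. -/
inductive Glue (F S : Type) where
  | neg : Glue F S
  | path : Pos → F → Glue F S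
  | sym : Pos → S → Glue F S

instance {F S : Type} [Countable F] [Countable S] : Countable (Glue F S) := by
  have h : Function.Injective
      (fun g : Glue F S => (match g with
        | .neg => Sum.inl ()
        | .path d f => Sum.inr (Sum.inl (d, f))
        | .sym d s => Sum.inr (Sum.inr (d, s)) : Unit ⊕ (Pos × F) ⊕ (Pos × S))) := by
    intro a b hab
    cases a <;> cases b <;> simp_all
  exact h.countable

/-- The strength of an optional glue. -/
def gstr {F S : Type} : Option (Glue F S) → ℤ
  | none => 0
  | some .neg => -1
  | some (.path _ _) => 1
  | some (.sym _ _) => 1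

/-- A tile description: an optional entry and exit of the path, an optional symbol that is read
and one that is written, and an optional repulsive side. -/
structure TD (F S : Type) where
  inp : Option (Pos × F)
  out : Option (Pos × F)
  symI : Option (Pos × S)
  symO : Option (Pos × S)
  neg : Option Pos

namespace TD

variable {F S : Type}

/-- The sides of a tile description that carry a glue. -/
def sides (t : TD F S) : List Pos :=
  (t.inp.map Prod.fst).toList ++ (t.out.map Prod.fst).toList ++ (t.symI.map Prod.fst).toList ++
    (t.symO.map Prod.fst).toList ++ t.neg.toList

/-- The sides are pairwise distinct unit vectors. -/
def WF (t : TD F S) : Prop := t.sides.Nodup ∧ ∀ u ∈ t.sides, u ∈ U2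

open Classical in
/-- The glue on side `u`; the glue names record the direction of flow. -/
noncomputable def glue (t : TD F S) (u : Pos) : Option (Glue F S) :=
  if h : ∃ f, t.inp = some (u, f) then some (.path (-u) h.choose)
  else if h : ∃ f, t.out = some (u, f) then some (.path u h.choose)
  else if h : ∃ s, t.symI = some (u, s) then some (.sym (-u) h.choose)
  else if h : ∃ s, t.symO = some (u, s) then some (.sym u h.choose)
  else if t.neg = some u then some .neg
  else none

theorem glue_inp {t : TD F S} {u : Pos} {f : F} (h : t.inp = some (u, f)) :
    t.glue u = some (.path (-u) f) := by
  have h' : ∃ f, t.inp = some (u, f) := ⟨f, h⟩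
  have := h.symm.trans h'.choose_spec
  simp only [Option.some.injEq, Prod.mk.injEq, true_and] at this
  rw [glue, dif_pos h', ← this]

theorem glue_out {t : TD F S} (ht : t.WF) {u : Pos} {f : F} (h : t.out = some (u, f)) :
    t.glue u = some (.path u f) := by
  have h1 : ¬ ∃ f, t.inp = some (u, f) := by
    rintro ⟨f', hf'⟩
    have := ht.1
    simp [sides, h, hf'] at this
  have h' : ∃ f, t.out = some (u, f) := ⟨f, h⟩
  have := h.symm.trans h'.choose_spec
  simp only [Option.some.injEq, Prod.mk.injEq, true_and] at this
  rw [glue, dif_neg h1, dif_pos h', ← this]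

theorem glue_symI {t : TD F S} (ht : t.WF) {u : Pos} {f : S} (h : t.symI = some (u, f)) :
    t.glue u = some (.sym (-u) f) := by
  have hn := ht.1
  have h1 : ¬ ∃ f, t.inp = some (u, f) := by
    rintro ⟨f', hf'⟩
    simp [sides, h, hf'] at hn
  have h2 : ¬ ∃ f, t.out = some (u, f) := by
    rintro ⟨f', hf'⟩
    simp [sides, h, hf', List.nodup_append] at hn
  have h' : ∃ f, t.symI = some (u, f) := ⟨f, h⟩
  have := h.symm.trans h'.choose_spec
  simp only [Option.some.injEq, Prod.mk.injEq, true_and] at this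
  rw [glue, dif_neg h1, dif_neg h2, dif_pos h', ← this]

theorem glue_symO {t : TD F S} (ht : t.WF) {u : Pos} {f : S} (h : t.symO = some (u, f)) :
    t.glue u = some (.sym u f) := by
  have hn := ht.1
  have h1 : ¬ ∃ f, t.inp = some (u, f) := by
    rintro ⟨f', hf'⟩
    simp [sides, h, hf'] at hn
  have h2 : ¬ ∃ f, t.out = some (u, f) := by
    rintro ⟨f', hf'⟩
    simp [sides, h, hf', List.nodup_append] at hn
  have h3 : ¬ ∃ f, t.symI = some (u, f) := by
    rintro ⟨f', hf'⟩
    simp [sides, h, hf', List.nodup_append] at hn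
  have h' : ∃ f, t.symO = some (u, f) := ⟨f, h⟩
  have := h.symm.trans h'.choose_spec
  simp only [Option.some.injEq, Prod.mk.injEq, true_and] at this
  rw [glue, dif_neg h1, dif_neg h2, dif_neg h3, dif_pos h', ← this]

theorem glue_neg {t : TD F S} (ht : t.WF) {u : Pos} (h : t.neg = some u) :
    t.glue u = some .neg := by
  have hn := ht.1
  have h1 : ¬ ∃ f, t.inp = some (u, f) := by
    rintro ⟨f', hf'⟩
    simp [sides, h, hf'] at hn
  have h2 : ¬ ∃ f, t.out = some (u, f) := by
    rintro ⟨f', hf'⟩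
    simp [sides, h, hf', List.nodup_append] at hn
  have h3 : ¬ ∃ f, t.symI = some (u, f) := by
    rintro ⟨f', hf'⟩
    simp [sides, h, hf', List.nodup_append] at hn
  have h4 : ¬ ∃ f, t.symO = some (u, f) := by
    rintro ⟨f', hf'⟩
    simp [sides, h, hf', List.nodup_append] at hn
  rw [glue, dif_neg h1, dif_neg h2, dif_neg h3, dif_neg h4, if_pos h]

theorem glue_path {t : TD F S} {u d : Pos} {f : F} (h : t.glue u = some (.path d f)) :
    (d = -u ∧ t.inp = some (u, f)) ∨ (d = u ∧ t.out = some (u, f)) := by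
  unfold glue at h
  split_ifs at h with h1 h2 h3 h4 h5
  · simp only [Option.some.injEq, Glue.path.injEq] at h
    exact Or.inl ⟨h.1.symm, h.2 ▸ h1.choose_spec⟩
  · simp only [Option.some.injEq, Glue.path.injEq] at h
    exact Or.inr ⟨h.1.symm, h.2 ▸ h2.choose_spec⟩
  all_goals simp at h

theorem glue_sym {t : TD F S} {u d : Pos} {f : S} (h : t.glue u = some (.sym d f)) :
    (d = -u ∧ t.symI = some (u, f)) ∨ (d = u ∧ t.symO = some (u, f)) := by
  unfold glue at h
  split_ifs at h with h1 h2 h3 h4 h5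
  · simp at h
  · simp at h
  · simp only [Option.some.injEq, Glue.sym.injEq] at h
    exact Or.inl ⟨h.1.symm, h.2 ▸ h3.choose_spec⟩
  · simp only [Option.some.injEq, Glue.sym.injEq] at h
    exact Or.inr ⟨h.1.symm, h.2 ▸ h4.choose_spec⟩
  all_goals simp at h

theorem neg_of_glue {t : TD F S} {u : Pos} (h : t.glue u = some .neg) : t.neg = some u := by
  unfold glue at h
  split_ifs at h with h1 h2 h3 h4 h5
  all_goals first | exact h5 | simp at h

variable [Countable F] [Countable S]

/-- An injective numbering of the glues. -/
noncomputable def code (F S : Type) [Countable F] [Countable S] : Option (Glue F S) → ℕ :=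
  (Countable.exists_injective_nat (Option (Glue F S))).choose

theorem code_injective : Function.Injective (code F S) :=
  (Countable.exists_injective_nat (Option (Glue F S))).choose_spec

/-- The tile with the given description. -/
noncomputable def tile (t : TD F S) : Tile where
  col u := code F S (t.glue u)
  str u := gstr (t.glue u)

open Classical in
theorem interaction_tile (t t' : TD F S) (u : Pos) :
    interaction t.tile t'.tile u = if t.glue u = t'.glue (-u) then gstr (t.glue u) else 0 := by
  unfold interaction tile
  by_cases h : t.glue u = t'.glue (-u)
  · simp [h]
  · rw [if_neg h, if_neg]
    rintro ⟨h1, -⟩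
    exact h (code_injective h1)

end TD

/-- `j` is directly followed by `i` along the path. -/
def Nx {I F S : Type} [LinearOrder I] (pos : I → Pos) (td : I → TD F S) (j i : I) : Prop :=
  j < i ∧ ∃ d f, pos i = pos j + d ∧ (td j).out = some (d, f) ∧ (td i).inp = some (-d, f)

/-- A self-avoiding path of tiles, some of which read a symbol glue inside a pocket that is guarded
by a repulsive glue. -/
structure PathSystem (I F S : Type) [LinearOrder I] where
  V : Finset I
  pos : I → Pos
  td : I → TD F S
  s0 : I
  s0_mem : s0 ∈ V
  s0_inp : (td s0).inp = none
  pos_inj : Set.InjOn pos V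
  wf : ∀ i ∈ V, (td i).WF
  pred : ∀ i ∈ V, i = s0 ∨ ∃ j ∈ V, Nx pos td j i
  succ : ∀ i ∈ V, (td i).out = none ∨ ∃ j ∈ V, Nx pos td i j
  det : ∀ i ∈ V, ∀ j ∈ V, (td i).inp = (td j).inp → (td i).inp ≠ none →
    ((td i).symI = (td j).symI → td i = td j) ∧
    (td i).symI.map Prod.fst = (td j).symI.map Prod.fst ∧ (td i).neg = (td j).neg
  guard : ∀ f ∈ V, ∀ d s, (td f).symO = some (d, s) → ∃ g ∈ V, g < f ∧ ∃ w, (td g).neg = some w ∧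
    pos g + w = pos f + d ∧ ∀ i ∈ V, (td i).symI = some (-d, s) → (td i).neg = some (-w)
  read : ∀ c ∈ V, ∀ w s, (td c).symI = some (w, s) → ∃ f ∈ V, f < c ∧ pos f = pos c + w ∧
    (td f).symO = some (-w, s)
  free : ∀ g ∈ V, ∀ w, (td g).neg = some w → (td g).symI = none →
    ∀ j ∈ V, pos j = pos g + w → g < j
  has_neg : ∃ g ∈ V, (td g).neg ≠ none

namespace PathSystem

variable {I F S : Type} [LinearOrder I] (P : PathSystem I F S)

theorem le_of_nx {j i a : I} (hj : j ∈ P.V) (hi : i ∈ P.V) (ha : a ∈ P.V)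
    (h : Nx P.pos P.td j i) (hja : j < a) : i ≤ a := by
  have key : ∀ n, ∀ a ∈ P.V, (P.V.filter (· < a)).card = n → ∀ j ∈ P.V, ∀ i ∈ P.V,
      Nx P.pos P.td j i → j < a → i ≤ a := by
    intro n
    induction n using Nat.strong_induction_on with
    | _ n ih =>
      intro a ha hn j hj i hi h hja
      have hlt : ∀ b ∈ P.V, b < a → (P.V.filter (· < b)).card < n := by
        intro b hb hba
        rw [← hn]
        apply Finset.card_lt_card
        refine ⟨?_, ?_⟩
        · intro x hx
          simp only [Finset.mem_filter] at hx ⊢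
          exact ⟨hx.1, hx.2.trans hba⟩
        · intro hsub
          have := hsub (Finset.mem_filter.2 ⟨hb, hba⟩)
          simp at this
      have hmin : ∀ b ∈ P.V, P.s0 ≤ b := by
        intro b hb
        have hne : P.V.Nonempty := ⟨_, P.s0_mem⟩
        have hm := P.V.min'_mem hne
        rcases P.pred _ hm with h0 | ⟨c, hc, hcm⟩
        · rw [← h0]; exact P.V.min'_le _ hb
        · exact absurd (P.V.min'_le _ hc) (not_le.2 hcm.1)
      rcases P.pred a ha with rfl | ⟨b, hb, hba⟩
      · exact absurd hja (not_lt.2 (hmin j hj))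
      · rcases lt_trichotomy j b with hjb | rfl | hbj
        · exact (ih _ (hlt b hb hba.1) b hb rfl j hj i hi h hjb).trans hba.1.le
        · obtain ⟨-, d, f, h1, h2, -⟩ := h
          obtain ⟨-, d', f', h1', h2', -⟩ := hba
          rw [h2] at h2'
          simp only [Option.some.injEq, Prod.mk.injEq] at h2'
          rw [← h2'.1, ← h1] at h1'
          exact (P.pos_inj ha hi h1').ge
        · exact absurd (ih _ (hlt j hj hja) j hj rfl b hb a ha hba hbj) (not_le.2 hja)
  exact key _ a ha rfl j hj i hi h hja

theorem s0_le {b : I} (hb : b ∈ P.V) : P.s0 ≤ b := by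
  have hne : P.V.Nonempty := ⟨_, P.s0_mem⟩
  have hm := P.V.min'_mem hne
  rcases P.pred _ hm with h0 | ⟨c, hc, hcm⟩
  · rw [← h0]; exact P.V.min'_le _ hb
  · exact absurd (P.V.min'_le _ hc) (not_le.2 hcm.1)

theorem mem_U2_of_neg {i : I} (hi : i ∈ P.V) {u : Pos} (h : (P.td i).neg = some u) : u ∈ U2 :=
  (P.wf i hi).2 u (by simp [TD.sides, h])

theorem mem_U2_of_inp {i : I} (hi : i ∈ P.V) {u : Pos} {f : F} (h : (P.td i).inp = some (u, f)) :
    u ∈ U2 :=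
  (P.wf i hi).2 u (by simp [TD.sides, h])

theorem mem_U2_of_symI {i : I} (hi : i ∈ P.V) {u : Pos} {f : S}
    (h : (P.td i).symI = some (u, f)) : u ∈ U2 :=
  (P.wf i hi).2 u (by simp [TD.sides, h])

variable [Countable F] [Countable S]

open Classical in
/-- The assembly that contains the path up to and including `a`. -/
noncomputable def asm (a : I) : Assembly := fun x =>
  if h : ∃ i ∈ P.V, i ≤ a ∧ P.pos i = x then some (P.td h.choose).tile else none

theorem asm_pos {a i : I} (hi : i ∈ P.V) (h : i ≤ a) : P.asm a (P.pos i) = some (P.td i).tile := by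
  have h' : ∃ j ∈ P.V, j ≤ a ∧ P.pos j = P.pos i := ⟨i, hi, h, rfl⟩
  have hs := h'.choose_spec
  rw [asm, dif_pos h', P.pos_inj hs.1 hi hs.2.2]

theorem asm_eq_none {a : I} {x : Pos} : P.asm a x = none ↔ ∀ i ∈ P.V, i ≤ a → P.pos i ≠ x := by
  unfold asm
  split_ifs with h
  · simp only [false_iff, not_forall, not_not]
    obtain ⟨i, h1, h2, h3⟩ := h
    exact ⟨i, h1, h2, h3⟩
  · simp only [true_iff]
    intro i h1 h2 h3
    exact h ⟨i, h1, h2, h3⟩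

open Classical in
/-- The contribution of side `u` to the binding strength. -/
noncomputable def contrib (a : I) (t : TD F S) (m u : Pos) : ℤ :=
  (P.asm a (m + u)).elim 0 (fun t' => interaction t.tile t' u)

theorem contrib_eq_zero_or (a : I) (t : TD F S) (m u : Pos) :
    P.contrib a t m u = 0 ∨ ∃ j ∈ P.V, j ≤ a ∧ P.pos j = m + u ∧ t.glue u = (P.td j).glue (-u) ∧
      P.contrib a t m u = gstr (t.glue u) := by
  classical
  by_cases h : ∃ j ∈ P.V, j ≤ a ∧ P.pos j = m + u
  · obtain ⟨j, hj, hja, hp⟩ := h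
    have e : P.contrib a t m u =
        if t.glue u = (P.td j).glue (-u) then gstr (t.glue u) else 0 := by
      rw [contrib, ← hp, P.asm_pos hj hja, Option.elim_some, TD.interaction_tile]
    by_cases hg : t.glue u = (P.td j).glue (-u)
    · rw [if_pos hg] at e
      exact Or.inr ⟨j, hj, hja, hp, hg, e⟩
    · rw [if_neg hg] at e
      exact Or.inl e
  · left
    have : P.asm a (m + u) = none := by
      rw [asm_eq_none]
      intro i hi hia hp
      exact h ⟨i, hi, hia, hp⟩
    rw [contrib, this, Option.elim_none]

theorem contrib_eq {a j : I} (hj : j ∈ P.V) (hja : j ≤ a) {t : TD F S} {m u : Pos}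
    (hp : P.pos j = m + u) (hg : t.glue u = (P.td j).glue (-u)) :
    P.contrib a t m u = gstr (t.glue u) := by
  rw [contrib, ← hp, P.asm_pos hj hja, Option.elim_some, TD.interaction_tile, if_pos hg]

end PathSystem

theorem ne_neg_of_mem_U2 {u : Pos} (h : u ∈ U2) : u ≠ -u := by
  revert u; decide

namespace PathSystem

variable {I F S : Type} [LinearOrder I] (P : PathSystem I F S)
variable [Countable F] [Countable S]

/-- A side with a positive contribution is the entry side or the reading side. -/
theorem contrib_pos {a : I} (ha : a ∈ P.V) {m u : Pos} (hu : u ∈ U2) {t : TD F S}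
    (hm : P.asm a m = none) (h : 0 < P.contrib a t m u) :
    (∃ f, t.inp = some (u, f) ∧ P.pos a = m + u ∧ (P.td a).out = some (-u, f)) ∨
    (∃ s, t.symI = some (u, s) ∧ ∃ j ∈ P.V, j ≤ a ∧ P.pos j = m + u ∧
      (P.td j).symO = some (-u, s)) := by
  rw [asm_eq_none] at hm
  have hu' := ne_neg_of_mem_U2 hu
  rcases P.contrib_eq_zero_or a t m u with h0 | ⟨j, hj, hja, hp, hg, he⟩
  · omega
  rw [he] at h
  match hgl : t.glue u with
  | none => rw [hgl] at h; simp [gstr] at h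
  | some .neg => rw [hgl] at h; simp [gstr] at h
  | some (.path d f) =>
    rw [hgl] at hg
    rcases TD.glue_path hgl with ⟨rfl, h1⟩ | ⟨rfl, h1⟩ <;>
    rcases TD.glue_path hg.symm with ⟨h2, h3⟩ | ⟨h2, h3⟩
    · rw [neg_neg] at h2; exact absurd h2.symm hu'
    · left
      rcases P.succ j hj with h4 | ⟨b, hb, hjb⟩
      · rw [h3] at h4; simp at h4
      have hjb' := hjb
      obtain ⟨-, d', f', e1, e2, e3⟩ := hjb
      rw [h3] at e2
      simp only [Option.some.injEq, Prod.mk.injEq] at e2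
      rw [← e2.1, hp] at e1
      have hbm : P.pos b = m := by rw [e1]; abel
      have hba : ¬ b ≤ a := fun hba => hm b hb hba hbm
      rcases hja.lt_or_eq with hja | rfl
      · exact absurd (P.le_of_nx hj hb ha hjb' hja) hba
      · exact ⟨f, h1, hp, h3⟩
    · exfalso
      rcases P.pred j hj with rfl | ⟨k, hk, hkj, d', f', e1, e2, e3⟩
      · rw [P.s0_inp] at h3; simp at h3
      · rw [h3] at e3
        simp only [Option.some.injEq, Prod.mk.injEq, neg_inj] at e3
        rw [← e3.1, hp] at e1
        exact hm k hk (hkj.le.trans hja) (add_right_cancel e1).symm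
    · exact absurd h2 hu'
  | some (.sym d s) =>
    rw [hgl] at hg
    rcases TD.glue_sym hgl with ⟨rfl, h1⟩ | ⟨rfl, h1⟩ <;>
    rcases TD.glue_sym hg.symm with ⟨h2, h3⟩ | ⟨h2, h3⟩
    · rw [neg_neg] at h2; exact absurd h2.symm hu'
    · exact Or.inr ⟨s, h1, j, hj, hja, hp, h3⟩
    · exfalso
      obtain ⟨f, hf, hfj, e1, e2⟩ := P.read j hj _ _ h3
      refine hm f hf (hfj.le.trans hja) ?_
      rw [e1, hp]; abel
    · exact absurd h2 hu'

theorem contrib_le_one (a : I) (t : TD F S) (m u : Pos) : P.contrib a t m u ≤ 1 := by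
  rcases P.contrib_eq_zero_or a t m u with h | ⟨j, _, _, _, _, h⟩
  · omega
  · rw [h]; match t.glue u with
    | none => simp [gstr]
    | some .neg => simp [gstr]
    | some (.path d f) => simp [gstr]
    | some (.sym d f) => simp [gstr]

theorem neg_one_le_contrib (a : I) (t : TD F S) (m u : Pos) : -1 ≤ P.contrib a t m u := by
  rcases P.contrib_eq_zero_or a t m u with h | ⟨j, _, _, _, _, h⟩
  · omega
  · rw [h]; match t.glue u with
    | none => simp [gstr]
    | some .neg => simp [gstr]
    | some (.path d f) => simp [gstr]
    | some (.sym d f) => simp [gstr]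

/-- Only the repulsive side can contribute negatively, and only next to another repulsive side. -/
theorem neg_of_contrib_neg {a : I} {t : TD F S} {m u : Pos} (h : P.contrib a t m u < 0) :
    t.neg = some u ∧ ∃ j ∈ P.V, j ≤ a ∧ P.pos j = m + u ∧ (P.td j).neg = some (-u) := by
  rcases P.contrib_eq_zero_or a t m u with h0 | ⟨j, hj, hja, hp, hg, he⟩
  · omega
  rw [he] at h
  match hgl : t.glue u with
  | none => rw [hgl] at h; simp [gstr] at h
  | some .neg =>
    rw [hgl] at hg
    exact ⟨TD.neg_of_glue hgl, j, hj, hja, hp, TD.neg_of_glue hg.symm⟩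
  | some (.path d f) => rw [hgl] at h; simp [gstr] at h
  | some (.sym d s) => rw [hgl] at h; simp [gstr] at h

theorem bindStrength_eq (a : I) (t : TD F S) (m : Pos) :
    bindStrength (P.asm a) t.tile m = ∑ u ∈ U2, P.contrib a t m u := rfl

/-- The symbol-reading gadget: a tile that reads a symbol only attaches when both its entry and its
symbol match. -/
theorem sum_contrib_le {a : I} {t : TD F S} {m w v : Pos}
    (hv : v ∈ U2) (hneg : P.contrib a t m v = -1)
    (h : ∀ u ∈ U2, 0 < P.contrib a t m u → u = w) : ∑ u ∈ U2, P.contrib a t m u ≤ 0 := by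
  have : ∀ u ∈ U2, P.contrib a t m u ≤ (if u = w then 1 else 0) + (if u = v then -1 else 0) := by
    intro u hu
    have h1 := P.contrib_le_one a t m u
    have h2 := h u hu
    by_cases huv : u = v
    · subst huv
      rw [hneg, if_pos rfl]; split_ifs <;> omega
    · rw [if_neg huv]
      split_ifs with h3
      · omega
      · by_contra h4
        exact h3 (h2 (by omega))
  refine (Finset.sum_le_sum this).trans ?_
  rw [Finset.sum_add_distrib, Finset.sum_ite_eq', Finset.sum_ite_eq', if_pos hv]
  split_ifs <;> omega

theorem contrib_neg_eq {a g i : I} (hg : g ∈ P.V) (hi : i ∈ P.V) (hga : g ≤ a) {m v : Pos}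
    (h1 : (P.td g).neg = some v) (h2 : (P.td i).neg = some (-v)) (hp : P.pos g + v = m) :
    P.contrib a (P.td i) m (-v) = -1 := by
  have hgl := TD.glue_neg (P.wf i hi) h2
  rw [P.contrib_eq hg hga (by rw [← hp]; abel), hgl]
  · rfl
  · rw [hgl, neg_neg, TD.glue_neg (P.wf g hg) h1]

/-- Only the next tile of the path can attach. -/
theorem next_of_bind {a i : I} (ha : a ∈ P.V) (hi : i ∈ P.V) {m : Pos} (hm : P.asm a m = none)
    (hb : 1 ≤ bindStrength (P.asm a) (P.td i).tile m) :
    ∃ b ∈ P.V, Nx P.pos P.td a b ∧ P.pos b = m ∧ P.td i = P.td b := by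
  rw [bindStrength_eq] at hb
  have hcp : ∀ u ∈ U2, 0 < P.contrib a (P.td i) m u → _ := fun u hu h =>
    P.contrib_pos ha hu hm h
  -- a symbol match comes with a repulsion
  have hsym : ∀ u s, (P.td i).symI = some (u, s) → ∀ j ∈ P.V, j ≤ a → P.pos j = m + u →
      (P.td j).symO = some (-u, s) → ∃ v ∈ U2, P.contrib a (P.td i) m v = -1 := by
    intro u s h1 j hj hja hp h2
    obtain ⟨g, hg, hgj, v, e1, e2, e3⟩ := P.guard j hj _ _ h2
    have e4 := e3 i hi (by rw [neg_neg]; exact h1)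
    exact ⟨-v, P.mem_U2_of_neg hi e4,
      P.contrib_neg_eq hg hi (hgj.le.trans hja) e1 e4 (by rw [e2, hp]; abel)⟩
  by_cases hI : ∃ u f, (P.td i).inp = some (u, f) ∧ P.pos a = m + u ∧ (P.td a).out = some (-u, f)
  · obtain ⟨u, f, h1, h2, h3⟩ := hI
    have huU := P.mem_U2_of_inp hi h1
    rcases P.succ a ha with h4 | ⟨b, hb', hnx⟩
    · rw [h3] at h4; simp at h4
    have hnx' := hnx
    obtain ⟨-, d', f', e1, e2, e3⟩ := hnx
    rw [h3] at e2
    simp only [Option.some.injEq, Prod.mk.injEq] at e2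
    rw [← e2.1, ← e2.2, neg_neg] at e3
    rw [← e2.1, h2] at e1
    have hbm : P.pos b = m := by rw [e1]; abel
    refine ⟨b, hb', hnx', hbm, ?_⟩
    obtain ⟨D1, D2, D3⟩ := P.det i hi b hb' (by rw [h1, e3]) (by rw [h1]; simp)
    apply D1
    rcases hsb : (P.td b).symI with - | ⟨w, s⟩
    · rw [hsb] at D2
      simpa using D2
    · rw [hsb] at D2
      obtain ⟨⟨w', s'⟩, hsi, hw⟩ := Option.map_eq_some_iff.1 D2
      simp only at hw
      subst hw
      obtain ⟨k, hk, hkb, e4, e5⟩ := P.read b hb' _ _ hsb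
      have hka : k ≤ a := by
        by_contra hka
        exact absurd (P.le_of_nx ha hb' hk hnx' (not_le.1 hka)) (not_le.2 hkb)
      rw [hbm] at e4
      obtain ⟨g, hg, hgk, v, e6, e7, e8⟩ := P.guard k hk _ _ e5
      have e9 := e8 b hb' (by rw [neg_neg]; exact hsb)
      rw [← D3] at e9
      have hneg := P.contrib_neg_eq hg hi (hgk.le.trans hka) e6 e9 (m := m) (by rw [e7, e4]; abel)
      by_cases hS : 0 < P.contrib a (P.td i) m w'
      · rcases hcp w' (P.mem_U2_of_symI hi hsi) hS
          with ⟨f'', h5, h6, h7⟩ | ⟨s'', h5, j, hj, hja, hp, h6⟩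
        · exfalso
          have := (P.wf i hi).1
          simp [TD.sides, h5, hsi] at this
        · have hjk : j = k := P.pos_inj hj hk (by rw [hp, e4])
          rw [hjk, e5] at h6
          rw [hsi] at h5 ⊢
          simp only [Option.some.injEq, Prod.mk.injEq, true_and] at h5 h6
          rw [h5, h6]
      · exfalso
        have := P.sum_contrib_le (w := u) (P.mem_U2_of_neg hi e9) hneg (by
          intro u' hu' hpos
          rcases hcp u' hu' hpos with ⟨f'', h5, h6, h7⟩ | ⟨s'', h5, j, hj, hja, hp, h6⟩
          · rw [h5] at h1
            simp only [Option.some.injEq, Prod.mk.injEq] at h1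
            exact h1.1
          · rw [hsi] at h5
            simp only [Option.some.injEq, Prod.mk.injEq] at h5
            rw [h5.1] at hS
            exact absurd hpos hS)
        omega
  · exfalso
    have hcp' : ∀ u ∈ U2, 0 < P.contrib a (P.td i) m u → (∃ s, (P.td i).symI = some (u, s) ∧
        ∃ j ∈ P.V, j ≤ a ∧ P.pos j = m + u ∧ (P.td j).symO = some (-u, s)) := by
      intro u hu h
      rcases hcp u hu h with ⟨f, h1⟩ | h1
      · exact absurd ⟨u, f, h1⟩ hI
      · exact h1
    have hex : ∃ u ∈ U2, 0 < P.contrib a (P.td i) m u := by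
      by_contra hno
      push Not at hno
      have := Finset.sum_nonpos hno
      omega
    obtain ⟨w, hw, hwpos⟩ := hex
    obtain ⟨s, h1, j, hj, hja, hp, h2⟩ := hcp' w hw hwpos
    obtain ⟨v, hv, hvn⟩ := hsym w s h1 j hj hja hp h2
    have := P.sum_contrib_le (w := w) hv hvn (by
      intro u hu hpos
      obtain ⟨s', h3, -⟩ := hcp' u hu hpos
      rw [h1] at h3
      simp only [Option.some.injEq, Prod.mk.injEq] at h3
      exact h3.1.symm)
    omega

/-- The next tile of the path can attach. -/
theorem bind_of_next {a b : I} (ha : a ∈ P.V) (hb : b ∈ P.V) (h : Nx P.pos P.td a b) :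
    P.asm a (P.pos b) = none ∧ 1 ≤ bindStrength (P.asm a) (P.td b).tile (P.pos b) := by
  have hnx := h
  obtain ⟨hab, d, f, h1, h2, h3⟩ := h
  refine ⟨?_, ?_⟩
  · rw [asm_eq_none]
    intro i hi hia hp
    rw [P.pos_inj hi hb hp] at hia
    exact absurd hab (not_lt.2 hia)
  rw [bindStrength_eq]
  have hd := P.mem_U2_of_inp hb h3
  have hin : P.contrib a (P.td b) (P.pos b) (-d) = 1 := by
    rw [P.contrib_eq ha le_rfl (by rw [h1]; abel), TD.glue_inp h3]
    · rfl
    · rw [TD.glue_inp h3, neg_neg, TD.glue_out (P.wf a ha) h2]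
  rcases hs : (P.td b).symI with - | ⟨w, s⟩
  · have hnn : ∀ u ∈ U2, 0 ≤ P.contrib a (P.td b) (P.pos b) u := by
      intro u hu
      by_contra hneg
      obtain ⟨e1, j, hj, hja, hp, -⟩ := P.neg_of_contrib_neg (not_le.1 hneg)
      exact absurd (hja.trans_lt hab) (not_lt.2 (P.free b hb u e1 hs j hj hp).le)
    rw [← hin]
    exact Finset.single_le_sum hnn hd
  · obtain ⟨k, hk, hkb, e4, e5⟩ := P.read b hb _ _ hs
    have hka : k ≤ a := by
      by_contra hka
      exact absurd (P.le_of_nx ha hb hk hnx (not_le.1 hka)) (not_le.2 hkb)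
    have hw := P.mem_U2_of_symI hb hs
    have hsy : P.contrib a (P.td b) (P.pos b) w = 1 := by
      rw [P.contrib_eq hk hka e4, TD.glue_symI (P.wf b hb) hs]
      · rfl
      · rw [TD.glue_symI (P.wf b hb) hs, TD.glue_symO (P.wf k hk) e5]
    have hne : -d ≠ w := by
      have := (P.wf b hb).1
      intro hdw
      simp [TD.sides, h3, hs, hdw] at this
    obtain ⟨v, hv⟩ : ∃ v, ∀ u, (P.td b).neg = some u → u = v := by
      rcases (P.td b).neg with - | v
      · exact ⟨0, by simp⟩
      · exact ⟨v, by simp [eq_comm]⟩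
    have : ∀ u ∈ U2, (if u = -d then 1 else 0) + (if u = w then 1 else 0)
        + (if u = v then -1 else 0)
        ≤ P.contrib a (P.td b) (P.pos b) u := by
      intro u hu
      have l1 := P.neg_one_le_contrib a (P.td b) (P.pos b) u
      by_cases hud : u = -d
      · rw [hud, if_pos rfl, if_neg hne, hin]; split_ifs <;> omega
      by_cases huw : u = w
      · rw [huw, if_pos rfl, if_neg (Ne.symm hne), hsy]; split_ifs <;> omega
      rw [if_neg hud, if_neg huw]
      split_ifs with h5
      · omega
      · by_contra hlt
        have hlt' : P.contrib a (P.td b) (P.pos b) u < 0 := by omega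
        exact h5 (hv u (P.neg_of_contrib_neg hlt').1)
    refine le_trans ?_ (Finset.sum_le_sum this)
    rw [Finset.sum_add_distrib, Finset.sum_add_distrib, Finset.sum_ite_eq', Finset.sum_ite_eq',
      Finset.sum_ite_eq', if_pos hd, if_pos hw]
    split_ifs <;> omega

open Classical in
/-- The tile assembly system whose tiles are those of the path. -/
noncomputable def tas : TAS where
  tiles := P.V.image fun i => (P.td i).tile
  seedTile := (P.td P.s0).tile
  temp := 1
  seed_mem := Finset.mem_image_of_mem _ P.s0_mem

theorem isRgTAS : IsRgTAS P.tas := by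
  classical
  refine ⟨⟨?_, ?_⟩, rfl⟩
  · intro t ht u _
    simp only [tas, Finset.mem_image] at ht
    obtain ⟨i, -, rfl⟩ := ht
    change gstr _ ∈ _
    match (P.td i).glue u with
    | none => simp [gstr]
    | some .neg => simp [gstr]
    | some (.path d f) => simp [gstr]
    | some (.sym d s) => simp [gstr]
  · refine ⟨TD.code F S (some .neg), ?_, ?_⟩
    · obtain ⟨g, hg, hn⟩ := P.has_neg
      obtain ⟨u, hu⟩ := Option.ne_none_iff_exists'.1 hn
      refine ⟨(P.td g).tile, Finset.mem_image_of_mem _ hg, u, P.mem_U2_of_neg hg hu, ?_, ?_⟩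
      · simp [TD.tile, TD.glue_neg (P.wf g hg) hu]
      · simp [TD.tile, TD.glue_neg (P.wf g hg) hu, gstr]
    · rintro c ⟨t, ht, u, hu, rfl, h⟩
      simp only [tas, Finset.mem_image] at ht
      obtain ⟨i, -, rfl⟩ := ht
      change gstr _ = _ at h
      change TD.code F S _ = _
      match hgl : (P.td i).glue u with
      | none => simp [gstr, hgl] at h
      | some .neg => rfl
      | some (.path d f) => simp [gstr, hgl] at h
      | some (.sym d s) => simp [gstr, hgl] at h

theorem card_tas_le [DecidableEq (TD F S)] : P.tas.tiles.card ≤ (P.V.image P.td).card := by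
  classical
  have : P.tas.tiles = (P.V.image P.td).image TD.tile := by
    rw [Finset.image_image]; rfl
  rw [this]
  exact Finset.card_image_le

end PathSystem
namespace PathSystem

variable {I F S : Type} [LinearOrder I] (P : PathSystem I F S)

theorem exists_max : ∃ z ∈ P.V, ∀ i ∈ P.V, i ≤ z :=
  ⟨P.V.max' ⟨_, P.s0_mem⟩, P.V.max'_mem _, fun i hi => P.V.le_max' i hi⟩

theorem exists_nx {a z : I} (ha : a ∈ P.V) (hz : z ∈ P.V) (haz : a < z) :
    ∃ b ∈ P.V, Nx P.pos P.td a b := by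
  have hne : (P.V.filter (a < ·)).Nonempty := ⟨z, Finset.mem_filter.2 ⟨hz, haz⟩⟩
  obtain ⟨hb, hab⟩ := Finset.mem_filter.1 ((P.V.filter (a < ·)).min'_mem hne)
  have hmin : ∀ c ∈ P.V, a < c → (P.V.filter (a < ·)).min' hne ≤ c := fun c hc hac =>
    Finset.min'_le _ _ (Finset.mem_filter.2 ⟨hc, hac⟩)
  generalize (P.V.filter (a < ·)).min' hne = b at *
  refine ⟨b, hb, ?_⟩
  rcases P.pred b hb with rfl | ⟨j, hj, hjb⟩
  · exact absurd hab (not_lt.2 (P.s0_le ha))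
  · rcases lt_trichotomy j a with h | rfl | h
    · exact absurd (P.le_of_nx hj hb ha hjb h) (not_le.2 hab)
    · exact hjb
    · exact absurd (hmin j hj h) (not_le.2 hjb.1)

variable [Countable F] [Countable S]

theorem asm_update {a b : I} (ha : a ∈ P.V) (hb : b ∈ P.V) (h : Nx P.pos P.td a b) :
    Function.update (P.asm a) (P.pos b) (some (P.td b).tile) = P.asm b := by
  classical
  funext x
  by_cases hx : x = P.pos b
  · subst hx
    rw [Function.update_self, P.asm_pos hb le_rfl]
  · rw [Function.update_of_ne hx]
    by_cases hi : ∃ i ∈ P.V, i ≤ a ∧ P.pos i = x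
    · obtain ⟨i, hi, hia, rfl⟩ := hi
      rw [P.asm_pos hi hia, P.asm_pos hi (hia.trans h.1.le)]
    · rw [P.asm_eq_none.2 (fun i h1 h2 h3 => hi ⟨i, h1, h2, h3⟩), eq_comm, P.asm_eq_none]
      intro i h1 h2 h3
      apply hi
      refine ⟨i, h1, ?_, h3⟩
      by_contra hia
      have := P.le_of_nx ha hb h1 h (not_le.1 hia)
      rw [le_antisymm h2 this] at h3
      exact hx h3.symm

theorem seed_eq (h0 : P.pos P.s0 = 0) : P.tas.seed = P.asm P.s0 := by
  funext x
  unfold TAS.seed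
  split_ifs with hx
  · rw [hx, show ((0, 0) : Pos) = P.pos P.s0 from h0.symm, P.asm_pos P.s0_mem le_rfl]; rfl
  · rw [eq_comm, asm_eq_none]
    intro i hi hle hp
    rw [le_antisymm hle (P.s0_le hi), h0] at hp
    exact hx hp.symm

theorem asm_step {a : I} {β : Assembly} (ha : a ∈ P.V) (h : Step P.tas (P.asm a) β) :
    ∃ b ∈ P.V, a ≤ b ∧ β = P.asm b := by
  classical
  obtain ⟨m, t, ⟨ht, hm, hb⟩, rfl⟩ := h
  obtain ⟨i, hi, rfl⟩ := Finset.mem_image.1 ht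
  obtain ⟨b, hbV, hnx, rfl, he⟩ := P.next_of_bind ha hi hm hb
  refine ⟨b, hbV, hnx.1.le, ?_⟩
  rw [← P.asm_update ha hbV hnx]
  simp only [he]

theorem step_asm {a b : I} (ha : a ∈ P.V) (hb : b ∈ P.V) (h : Nx P.pos P.td a b) :
    Step P.tas (P.asm a) (P.asm b) := by
  classical
  obtain ⟨h1, h2⟩ := P.bind_of_next ha hb h
  exact ⟨P.pos b, (P.td b).tile, ⟨Finset.mem_image_of_mem _ hb, h1, h2⟩,
    (P.asm_update ha hb h).symm⟩

theorem asmSeq_eq (h0 : P.pos P.s0 = 0) {f : ℕ → Assembly} (hf : AsmSeq P.tas f) :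
    ∃ a : ℕ → I, Monotone a ∧ ∀ k, a k ∈ P.V ∧ f k = P.asm (a k) := by
  have hstep : ∀ k, ∀ x : {x : I // x ∈ P.V ∧ f k = P.asm x},
      ∃ y : {x : I // x ∈ P.V ∧ f (k + 1) = P.asm x}, x.1 ≤ y.1 := by
    rintro k ⟨x, hx, hfx⟩
    rcases hf.2 k with h | h
    · rw [hfx] at h
      obtain ⟨b, hb, hle, he⟩ := P.asm_step hx h
      exact ⟨⟨b, hb, he⟩, hle⟩
    · exact ⟨⟨x, hx, h.trans hfx⟩, le_rfl⟩
  choose g hg using hstep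
  let a : ∀ k, {x : I // x ∈ P.V ∧ f k = P.asm x} := fun k =>
    Nat.rec ⟨P.s0, P.s0_mem, hf.1.trans (P.seed_eq h0)⟩ (fun k x => g k x) k
  refine ⟨fun k => (a k).1, monotone_nat_of_le_succ fun k => hg k (a k), fun k => (a k).2⟩

theorem terminal_eq (h0 : P.pos P.s0 = 0) {z : I} (hz : z ∈ P.V) (hmax : ∀ i ∈ P.V, i ≤ z)
    {α : Assembly} (hα : Terminal P.tas α) : α = P.asm z := by
  obtain ⟨⟨f, hf, hr⟩, hst⟩ := hα
  obtain ⟨a, hmono, ha⟩ := P.asmSeq_eq h0 hf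
  obtain ⟨k, hk⟩ : ∃ k, ∀ l, a l ≤ a k := by
    have hfin : (Set.range a).Finite := P.V.finite_toSet.subset (by
      rintro _ ⟨k, rfl⟩; exact (ha k).1)
    obtain ⟨_, ⟨⟨k, rfl⟩, hk⟩⟩ := hfin.exists_maximal (Set.range_nonempty a)
    refine ⟨k, fun l => ?_⟩
    rcases le_total (a l) (a k) with h | h
    · exact h
    · exact hk ⟨l, rfl⟩ h
  have hαk : α = P.asm (a k) := by
    funext x
    rcases hr x with ⟨l, h1, h2⟩ | ⟨h1, h2⟩
    · rw [← h1, (ha l).2]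
      rw [(ha l).2, Ne, asm_eq_none] at h2
      push Not at h2
      obtain ⟨i, hi, hil, rfl⟩ := h2
      rw [P.asm_pos hi hil, P.asm_pos hi (hil.trans (hk l))]
    · rw [h1, ← (ha k).2, h2]
  rcases (hmax _ (ha k).1).lt_or_eq with hlt | he
  · exfalso
    obtain ⟨b, hb, hnx⟩ := P.exists_nx (ha k).1 hz hlt
    obtain ⟨m, t, hc, -⟩ := P.step_asm (ha k).1 hb hnx
    rw [← hαk] at hc
    exact hst m t hc
  · rw [hαk, he]

theorem exists_asmSeq (h0 : P.pos P.s0 = 0) {a : I} (ha : a ∈ P.V) :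
    ∃ f, AsmSeq P.tas f ∧ ∃ n, ∀ k, n ≤ k → f k = P.asm a := by
  have key : ∀ n, ∀ a ∈ P.V, (P.V.filter (· < a)).card = n →
      ∃ f, AsmSeq P.tas f ∧ ∃ n, ∀ k, n ≤ k → f k = P.asm a := by
    intro n
    induction n using Nat.strong_induction_on with
    | _ n ih =>
      intro a ha hn
      rcases P.pred a ha with rfl | ⟨b, hb, hba⟩
      · exact ⟨fun _ => P.asm P.s0, ⟨(P.seed_eq h0).symm, fun _ => Or.inr rfl⟩, 0, fun _ _ => rfl⟩
      · have hlt : (P.V.filter (· < b)).card < n := by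
          rw [← hn]
          apply Finset.card_lt_card
          refine ⟨?_, ?_⟩
          · intro x hx
            simp only [Finset.mem_filter] at hx ⊢
            exact ⟨hx.1, hx.2.trans hba.1⟩
          · intro hsub
            have := hsub (Finset.mem_filter.2 ⟨hb, hba.1⟩)
            simp at this
        obtain ⟨f, ⟨hf0, hf⟩, l, hl⟩ := ih _ hlt b hb rfl
        refine ⟨fun k => if k ≤ l then f k else P.asm a, ⟨?_, ?_⟩, l + 1, ?_⟩
        · simpa using hf0
        · intro i
          rcases lt_trichotomy i l with h | rfl | h
          · simp only [h.le, if_true, Nat.succ_le_of_lt h]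
            exact hf i
          · left
            simp only [le_refl, if_true, Nat.not_succ_le_self, if_false, hl i le_rfl]
            exact P.step_asm hb ha hba
          · right
            simp only [show ¬ i + 1 ≤ l by omega, show ¬ i ≤ l by omega, if_false]
        · intro k hk
          simp only [show ¬ k ≤ l by omega, if_false]
  exact key _ a ha rfl

theorem terminal_asm (h0 : P.pos P.s0 = 0) {z : I} (hz : z ∈ P.V) (hmax : ∀ i ∈ P.V, i ≤ z) :
    Terminal P.tas (P.asm z) := by
  classical
  refine ⟨?_, ?_⟩
  · obtain ⟨f, hf, n, hn⟩ := P.exists_asmSeq h0 hz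
    refine ⟨f, hf, fun x => ?_⟩
    by_cases hx : P.asm z x = none
    · right
      refine ⟨hx, fun k => ?_⟩
      obtain ⟨a, -, ha⟩ := P.asmSeq_eq h0 hf
      rw [(ha k).2, asm_eq_none]
      rw [asm_eq_none] at hx
      exact fun i hi _ => hx i hi (hmax i hi)
    · exact Or.inl ⟨n, by rw [hn n le_rfl], by rwa [hn n le_rfl]⟩
  · rintro m t ⟨ht, hm, hb⟩
    obtain ⟨i, hi, rfl⟩ := Finset.mem_image.1 ht
    obtain ⟨b, hb, hnx, -, -⟩ := P.next_of_bind hz hi hm hb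
    exact absurd hnx.1 (not_lt.2 (hmax b hb))

theorem adom_asm {z : I} (hmax : ∀ i ∈ P.V, i ≤ z) : adom (P.asm z) = P.pos '' P.V := by
  ext x
  simp only [adom, Set.mem_ofPred_eq, Ne, asm_eq_none, Set.mem_image, Finset.mem_coe]
  push Not
  exact ⟨fun ⟨i, h1, _, h3⟩ => ⟨i, h1, h3⟩, fun ⟨i, h1, h3⟩ => ⟨i, h1, hmax i h1, h3⟩⟩

/-- The path system shifted by a vector. -/
def shift (v : Pos) : PathSystem I F S where
  V := P.V
  pos i := P.pos i + v
  td := P.td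
  s0 := P.s0
  s0_mem := P.s0_mem
  s0_inp := P.s0_inp
  pos_inj := fun i hi j hj h => P.pos_inj hi hj (add_right_cancel h)
  wf := P.wf
  pred i hi := by
    rcases P.pred i hi with h | ⟨j, hj, hji, d, f, h1, h2⟩
    · exact Or.inl h
    · exact Or.inr ⟨j, hj, hji, d, f, by simp only [h1]; abel, h2⟩
  succ i hi := by
    rcases P.succ i hi with h | ⟨j, hj, hji, d, f, h1, h2⟩
    · exact Or.inl h
    · exact Or.inr ⟨j, hj, hji, d, f, by simp only [h1]; abel, h2⟩
  det := P.det
  guard f hf d s h := by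
    obtain ⟨g, hg, hgf, w, h1, h2, h3⟩ := P.guard f hf d s h
    exact ⟨g, hg, hgf, w, h1, by rw [add_right_comm, h2]; abel, h3⟩
  read c hc w s h := by
    obtain ⟨f, hf, hfc, h1, h2⟩ := P.read c hc w s h
    exact ⟨f, hf, hfc, by simp only [h1]; abel, h2⟩
  free g hg w h1 h2 j hj h3 := P.free g hg w h1 h2 j hj (by
    rw [add_right_comm] at h3; exact add_right_cancel h3)
  has_neg := P.has_neg

/-- A path system whose positions fill a translate of `X` yields a glue-restricted system that
assembles `X`. -/
theorem exists_tas [DecidableEq (TD F S)] {X : Set Pos} {v : Pos}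
    (hX : P.pos '' P.V = (fun p => p + v) '' X) :
    ∃ 𝒯 : TAS, IsRgTAS 𝒯 ∧ DirectedTAS 𝒯 ∧ StrictlySelfAssembles 𝒯 X ∧
      𝒯.tiles.card ≤ (P.V.image P.td).card := by
  set Q := P.shift (-P.pos P.s0) with hQ
  have h0 : Q.pos Q.s0 = 0 := by simp [hQ, shift]
  obtain ⟨z, hz, hmax⟩ := Q.exists_max
  refine ⟨Q.tas, Q.isRgTAS, ⟨Q.asm z, Q.terminal_asm h0 hz hmax, fun α hα =>
    Q.terminal_eq h0 hz hmax hα⟩, fun α hα => ⟨v - P.pos P.s0, ?_⟩, Q.card_tas_le⟩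
  rw [Q.terminal_eq h0 hz hmax hα, Q.adom_asm hmax]
  have h1 : Q.pos '' (Q.V : Set I) = (fun p => p + -P.pos P.s0) '' (P.pos '' P.V) := by
    rw [Set.image_image]; rfl
  rw [h1, hX, Set.image_image]
  congr 1
  funext p
  abel

end PathSystem

/-- The geometry of a block of consecutive path tiles: their relative positions, the entry side,
the reading and repulsive sides of the first tile, and the step and direction of the bump and of the
floor of the pocket that the block leaves behind. -/
structure Shape where
  rel : List Pos
  ed : Pos
  rdDir : Pos
  ngDir : Pos
  bump : ℕ × Pos
  floor : ℕ × Pos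

namespace Shape

/-- The relative position of step `s`. -/
def r (sh : Shape) (s : ℕ) : Pos := sh.rel.getD s 0

/-- The glued sides of the tile at step `s`, where the flags say whether the block has a
predecessor, reads, and writes, and `x` is the exit direction. -/
def sidesAt (sh : Shape) (e r w : Bool) (x : Option Pos) (s : ℕ) : List Pos :=
  (if s = 0 then (if e then [sh.ed] else []) else [sh.r (s - 1) - sh.r s]) ++
  (if s + 1 < sh.rel.length then [sh.r (s + 1) - sh.r s] else x.toList) ++
  (if s = 0 ∧ r then [sh.rdDir] else []) ++
  (if s = sh.floor.1 ∧ w then [sh.floor.2] else []) ++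
  (if s = 0 ∧ r then [sh.ngDir] else if s = sh.bump.1 ∧ w then [sh.bump.2] else [])

/-- Consistency of a shape with given flags and exit direction. -/
def Good (sh : Shape) (e r w : Bool) (x : Option Pos) : Prop :=
  sh.rel ≠ [] ∧ sh.rel.Nodup ∧
  (∀ s < sh.rel.length, (sh.sidesAt e r w x s).Nodup ∧ ∀ u ∈ sh.sidesAt e r w x s, u ∈ U2) ∧
  (w → 0 < sh.bump.1 ∧ sh.bump.1 < sh.floor.1 ∧ sh.floor.1 < sh.rel.length ∧
    sh.r sh.bump.1 + sh.bump.2 = sh.r sh.floor.1 + sh.floor.2)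

instance (sh : Shape) (e r w : Bool) (x : Option Pos) : Decidable (sh.Good e r w x) := by
  unfold Good; infer_instance

end Shape

/-- The description of the tile at step `s` of a block with entry family `k.1` and symbol `k.2`. -/
def blockTD {Fam S : Type} (shape : Option Fam → Shape) (wr : Option Fam × Option S → Option S)
    (ex : Option Fam × Option S → Option (Pos × Fam)) (k : Option Fam × Option S) (s : ℕ) :
    TD (Fam ⊕ ((Option Fam × Option S) × ℕ)) S where
  inp := if s = 0 then k.1.map (fun f => ((shape k.1).ed, Sum.inl f))
    else some ((shape k.1).r (s - 1) - (shape k.1).r s, Sum.inr (k, s))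
  out := if s + 1 < (shape k.1).rel.length then
      some ((shape k.1).r (s + 1) - (shape k.1).r s, Sum.inr (k, s + 1))
    else (ex k).map (fun q => (q.1, Sum.inl q.2))
  symI := if s = 0 then k.2.map (fun a => ((shape k.1).rdDir, a)) else none
  symO := if s = (shape k.1).floor.1 then (wr k).map (fun a => ((shape k.1).floor.2, a)) else none
  neg := if s = 0 ∧ k.2.isSome then some (shape k.1).ngDir
    else if s = (shape k.1).bump.1 ∧ (wr k).isSome then some (shape k.1).bump.2 else none

theorem blockTD_sides {Fam S : Type} (shape : Option Fam → Shape)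
    (wr : Option Fam × Option S → Option S) (ex : Option Fam × Option S → Option (Pos × Fam))
    (k : Option Fam × Option S) (s : ℕ) :
    (blockTD shape wr ex k s).sides = (shape k.1).sidesAt k.1.isSome k.2.isSome (wr k).isSome
      ((ex k).map Prod.fst) s := by
  unfold TD.sides blockTD Shape.sidesAt
  congr 1
  · congr 1
    · congr 1
      · congr 1
        · by_cases hs : s = 0
          · simp only [hs, if_true]; cases k.1 <;> simp
          · simp [hs]
        · by_cases hs : s + 1 < (shape k.1).rel.length
          · simp [hs]
          · simp only [hs, if_false]; cases ex k <;> simp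
      · by_cases hs : s = 0
        · simp only [hs, if_true]; cases k.2 <;> simp
        · simp [hs]
    · by_cases hs : s = (shape k.1).floor.1
      · simp only [hs, if_true]; cases wr k <;> simp
      · simp [hs]
  · simp only
    split_ifs <;> simp

/-- An index of a tile: a block and a step. -/
structure Ix (β : Type) where
  blk : β
  step : ℕ

/-- A path system made of blocks. -/
structure BlockSystem (β Fam S : Type) where
  shape : Option Fam → Shape
  wr : Option Fam × Option S → Option S
  ex : Option Fam × Option S → Option (Pos × Fam)
  W : Finset β
  ent : β → Option Fam
  rd : β → Option S
  org : β → Pos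
  row : β → ℤ
  col : β → ℤ
  b0 : β
  b0_mem : b0 ∈ W
  b0_ent : ent b0 = none
  good : ∀ b ∈ W, (shape (ent b)).Good (ent b).isSome (rd b).isSome (wr (ent b, rd b)).isSome
    ((ex (ent b, rd b)).map Prod.fst)
  pos_inj : ∀ b ∈ W, ∀ b' ∈ W, ∀ q ∈ (shape (ent b)).rel, ∀ q' ∈ (shape (ent b')).rel,
    org b + q = org b' + q' → b = b'
  pred : ∀ b ∈ W, b = b0 ∨ ∃ a ∈ W, (row a < row b ∨ row a = row b ∧ col a < col b) ∧ ∃ d f,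
    ex (ent a, rd a) = some (d, f) ∧ ent b = some f ∧ (shape (ent b)).ed = -d ∧
    org b + (shape (ent b)).r 0 = org a + (shape (ent a)).r ((shape (ent a)).rel.length - 1) + d
  succ : ∀ a ∈ W, ex (ent a, rd a) = none ∨ ∃ b ∈ W,
    (row a < row b ∨ row a = row b ∧ col a < col b) ∧ ∃ d f,
    ex (ent a, rd a) = some (d, f) ∧ ent b = some f ∧ (shape (ent b)).ed = -d ∧
    org b + (shape (ent b)).r 0 = org a + (shape (ent a)).r ((shape (ent a)).rel.length - 1) + d
  det : ∀ a ∈ W, ∀ b ∈ W, ent a ≠ none → ent a = ent b → (rd a).isSome = (rd b).isSome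
  guard : ∀ a ∈ W, ∀ b ∈ W, ∀ s, wr (ent a, rd a) = some s → rd b = some s →
    (shape (ent b)).ngDir = -(shape (ent a)).bump.2
  read : ∀ b ∈ W, ∀ s, rd b = some s → ∃ a ∈ W, (row a < row b ∨ row a = row b ∧ col a < col b) ∧
    wr (ent a, rd a) = some s ∧ (shape (ent a)).floor.2 = -(shape (ent b)).rdDir ∧
    org a + (shape (ent a)).r (shape (ent a)).floor.1 =
      org b + (shape (ent b)).r 0 + (shape (ent b)).rdDir
  free : ∀ a ∈ W, (wr (ent a, rd a)).isSome → ∃ b ∈ W,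
    (row a < row b ∨ row a = row b ∧ col a < col b) ∧
    org b + (shape (ent b)).r 0 =
      org a + (shape (ent a)).r (shape (ent a)).bump.1 + (shape (ent a)).bump.2
  has_neg : ∃ a ∈ W, (wr (ent a, rd a)).isSome

namespace BlockSystem

variable {β Fam S : Type} (B : BlockSystem β Fam S)

/-- The number of tiles of a block. -/
def len (b : β) : ℕ := (B.shape (B.ent b)).rel.length

/-- The key of a block, which determines its tiles. -/
def key (b : β) : Option Fam × Option S := (B.ent b, B.rd b)

/-- The description of the tile with a given index. -/
def td (i : Ix β) : TD (Fam ⊕ ((Option Fam × Option S) × ℕ)) S :=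
  blockTD B.shape B.wr B.ex (B.key i.blk) i.step

/-- The position of the tile with a given index. -/
def pos (i : Ix β) : Pos := B.org i.blk + (B.shape (B.ent i.blk)).r i.step

open Classical in
/-- The indices of all tiles. -/
noncomputable def V : Finset (Ix β) :=
  (B.W.sigma fun b => Finset.range (B.len b)).image fun q => ⟨q.1, q.2⟩

theorem mem_V {i : Ix β} : i ∈ B.V ↔ i.blk ∈ B.W ∧ i.step < B.len i.blk := by
  classical
  simp only [V, Finset.mem_image, Finset.mem_sigma, Finset.mem_range]
  constructor
  · rintro ⟨q, h, rfl⟩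
    exact h
  · intro h
    exact ⟨⟨i.blk, i.step⟩, h, rfl⟩

theorem card_V : B.V.card = ∑ b ∈ B.W, B.len b := by
  classical
  rw [V, Finset.card_image_of_injective, Finset.card_sigma]
  · simp
  · rintro ⟨a, s⟩ ⟨b, t⟩ h
    simp only [Ix.mk.injEq] at h
    obtain ⟨rfl, rfl⟩ := h
    rfl

theorem r_mem {b : β} {s : ℕ} (h : s < B.len b) :
    (B.shape (B.ent b)).r s ∈ (B.shape (B.ent b)).rel := by
  unfold Shape.r
  rw [List.getD_eq_getElem _ _ h]
  exact List.getElem_mem _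

theorem len_pos {b : β} (h : b ∈ B.W) : 0 < B.len b :=
  List.length_pos_iff.2 (B.good b h).1

theorem pos_injOn : Set.InjOn B.pos B.V := by
  rintro ⟨b, s⟩ hi ⟨b', s'⟩ hj h
  obtain ⟨h1, h2⟩ := B.mem_V.1 hi
  obtain ⟨h3, h4⟩ := B.mem_V.1 hj
  simp only at h1 h2 h3 h4
  unfold pos at h
  simp only at h
  obtain rfl := B.pos_inj b h1 b' h3 _ (B.r_mem h2) _ (B.r_mem h4) h
  have h5 := add_left_cancel h
  have h2' : s < (B.shape (B.ent b)).rel.length := h2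
  have h4' : s' < (B.shape (B.ent b)).rel.length := h4
  unfold Shape.r at h5
  rw [List.getD_eq_getElem _ _ h2', List.getD_eq_getElem _ _ h4'] at h5
  rw [(B.good b h1).2.1.getElem_inj_iff.1 h5]

theorem td_symO (a : β) (s : ℕ) : (B.td ⟨a, s⟩).symO = if s = (B.shape (B.ent a)).floor.1 then
    (B.wr (B.ent a, B.rd a)).map (fun x => ((B.shape (B.ent a)).floor.2, x)) else none := rfl

theorem td_neg (a : β) (s : ℕ) : (B.td ⟨a, s⟩).neg =
    if s = 0 ∧ (B.rd a).isSome then some (B.shape (B.ent a)).ngDir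
    else if s = (B.shape (B.ent a)).bump.1 ∧ (B.wr (B.ent a, B.rd a)).isSome then
      some (B.shape (B.ent a)).bump.2 else none := rfl

theorem td_symI (a : β) (s : ℕ) : (B.td ⟨a, s⟩).symI = if s = 0 then
    (B.rd a).map (fun x => ((B.shape (B.ent a)).rdDir, x)) else none := rfl

variable [Countable β]

/-- The order of the tiles along the path. -/
noncomputable def rank (i : Ix β) : ℤ ×ₗ ℤ ×ₗ ℕ ×ₗ ℕ :=
  toLex (B.row i.blk, toLex (B.col i.blk,
    toLex ((Countable.exists_injective_nat β).choose i.blk, i.step)))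

theorem rank_injective : Function.Injective B.rank := by
  rintro ⟨b, s⟩ ⟨b', s'⟩ h
  simp only [rank, EmbeddingLike.apply_eq_iff_eq, Prod.mk.injEq] at h
  obtain ⟨-, -, h1, rfl⟩ := h
  rw [(Countable.exists_injective_nat β).choose_spec h1]

/-- The linear order of the tiles along the path. -/
@[reducible] noncomputable def order : LinearOrder (Ix β) :=
    LinearOrder.lift' B.rank B.rank_injective

theorem lt_of_row {a b : β} {s t : ℕ}
    (h : B.row a < B.row b ∨ B.row a = B.row b ∧ B.col a < B.col b) :
    B.order.lt ⟨a, s⟩ ⟨b, t⟩ := by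
  change B.rank _ < B.rank _
  simp only [rank, Prod.Lex.toLex_lt_toLex]
  tauto

theorem lt_of_step {a : β} {s t : ℕ} (h : s < t) : B.order.lt ⟨a, s⟩ ⟨a, t⟩ := by
  change B.rank _ < B.rank _
  simp only [rank, Prod.Lex.toLex_lt_toLex]
  simp [h]

theorem nx_of_joint {a b : β} (ha : a ∈ B.W)
    (h : B.row a < B.row b ∨ B.row a = B.row b ∧ B.col a < B.col b) {d : Pos} {f : Fam}
    (h1 : B.ex (B.ent a, B.rd a) = some (d, f)) (h2 : B.ent b = some f)
    (h3 : (B.shape (B.ent b)).ed = -d)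
    (h4 : B.org b + (B.shape (B.ent b)).r 0 =
      B.org a + (B.shape (B.ent a)).r ((B.shape (B.ent a)).rel.length - 1) + d) :
    @Nx _ _ _ B.order B.pos B.td ⟨a, B.len a - 1⟩ ⟨b, 0⟩ := by
  refine ⟨B.lt_of_row h, d, Sum.inl f, h4, ?_, ?_⟩
  · have h5 := B.len_pos ha
    have : ¬ (B.len a - 1 + 1 < (B.shape (B.ent a)).rel.length) := by
      unfold len at *; omega
    simp only [td, blockTD, key, this, if_false, h1, Option.map_some]
  · simp only [td, blockTD, key, if_true, h2, Option.map_some]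
    rw [← h2, h3]

theorem nx_step {a : β} {s : ℕ} (h : s + 1 < B.len a) :
    @Nx _ _ _ B.order B.pos B.td ⟨a, s⟩ ⟨a, s + 1⟩ := by
  refine ⟨B.lt_of_step (Nat.lt_succ_self s),
      (B.shape (B.ent a)).r (s + 1) - (B.shape (B.ent a)).r s,
    Sum.inr (B.key a, s + 1), ?_, ?_, ?_⟩
  · simp only [pos]; abel
  · have : s + 1 < (B.shape (B.ent a)).rel.length := h
    simp only [td, blockTD, key, this, if_true]
  · simp [td, blockTD, key]

/-- The path system of a block system. -/
noncomputable def toPathSystem :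
    @PathSystem (Ix β) (Fam ⊕ ((Option Fam × Option S) × ℕ)) S B.order :=
  letI := B.order
  { V := B.V
    pos := B.pos
    td := B.td
    s0 := ⟨B.b0, 0⟩
    s0_mem := B.mem_V.2 ⟨B.b0_mem, B.len_pos B.b0_mem⟩
    s0_inp := by simp [td, blockTD, key, B.b0_ent]
    pos_inj := B.pos_injOn
    wf := by
      intro i hi
      obtain ⟨h1, h2⟩ := B.mem_V.1 hi
      unfold TD.WF td
      rw [blockTD_sides]
      exact (B.good _ h1).2.2.1 _ h2
    pred := by
      rintro ⟨b, s⟩ hi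
      obtain ⟨h1, h2⟩ := B.mem_V.1 hi
      simp only at h1 h2
      match s with
      | s + 1 => exact Or.inr ⟨⟨b, s⟩, B.mem_V.2 ⟨h1, (Nat.lt_succ_self s).trans h2⟩, B.nx_step h2⟩
      | 0 =>
        rcases B.pred b h1 with rfl | ⟨a, ha, hab, d, f, e1, e2, e3, e4⟩
        · exact Or.inl rfl
        · exact Or.inr ⟨⟨a, B.len a - 1⟩, B.mem_V.2 ⟨ha, Nat.sub_lt (B.len_pos ha) one_pos⟩,
            B.nx_of_joint ha hab e1 e2 e3 e4⟩
    succ := by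
      rintro ⟨a, s⟩ hi
      obtain ⟨h1, h2⟩ := B.mem_V.1 hi
      simp only at h1 h2
      by_cases hs : s + 1 < B.len a
      · exact Or.inr ⟨⟨a, s + 1⟩, B.mem_V.2 ⟨h1, hs⟩, B.nx_step hs⟩
      · have hs' : s = B.len a - 1 := by omega
        rcases B.succ a h1 with h0 | ⟨b, hb, hab, d, f, e1, e2, e3, e4⟩
        · left
          have : ¬ s + 1 < (B.shape (B.ent a)).rel.length := hs
          simp only [td, blockTD, key, this, if_false, h0, Option.map_none]
        · exact Or.inr ⟨⟨b, 0⟩, B.mem_V.2 ⟨hb, B.len_pos hb⟩,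
            hs' ▸ B.nx_of_joint h1 hab e1 e2 e3 e4⟩
    det := by
      rintro ⟨a, s⟩ hi ⟨b, t⟩ hj h hne
      obtain ⟨h1, -⟩ := B.mem_V.1 hi
      obtain ⟨h2, -⟩ := B.mem_V.1 hj
      simp only at h1 h2
      simp only [td, blockTD, key] at h hne
      by_cases hs : s = 0 <;> by_cases ht : t = 0
      · subst hs ht
        simp only [if_true] at h hne
        rcases hea : B.ent a with - | f
        · rw [hea] at hne; simp at hne
        rcases heb : B.ent b with - | f'
        · rw [hea, heb] at h; simp at h
        rw [hea, heb] at h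
        simp only [Option.map_some, Option.some.injEq, Prod.mk.injEq, Sum.inl.injEq] at h
        obtain ⟨-, rfl⟩ := h
        have hd := B.det a h1 b h2 (by simp [hea]) (hea.trans heb.symm)
        simp only [td, blockTD, key, hea, heb, if_true, true_and]
        rcases hra : B.rd a with - | x <;> rcases hrb : B.rd b with - | y
        · simp
        · simp [hra, hrb] at hd
        · simp [hra, hrb] at hd
        · refine ⟨?_, by simp, by simp⟩
          intro hxy
          simp only [Option.map_some, Option.some.injEq, Prod.mk.injEq, true_and] at hxy
          rw [hxy]
      · exfalso
        simp only [hs, ht, if_true, if_false] at h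
        rcases hea : B.ent a with - | f <;> simp [hea] at h
      · exfalso
        simp only [hs, ht, if_true, if_false] at h
        rcases hea : B.ent b with - | f <;> simp [hea] at h
      · simp only [hs, ht, if_false, Option.some.injEq, Prod.mk.injEq, Sum.inr.injEq] at h
        obtain ⟨-, ⟨h3, h4⟩, rfl⟩ := h
        have : B.td ⟨a, s⟩ = B.td ⟨b, s⟩ := by simp only [td, key, h3, h4]
        rw [this]
        simp
    guard := by
      rintro ⟨a, s⟩ hi d x h
      obtain ⟨h1, h2⟩ := B.mem_V.1 hi
      simp only at h1 h2
      rw [B.td_symO] at h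
      by_cases hs : s = (B.shape (B.ent a)).floor.1
      swap
      · rw [if_neg hs] at h; simp at h
      rw [if_pos hs] at h
      obtain ⟨x', hx, h3⟩ := Option.map_eq_some_iff.1 h
      simp only [Prod.mk.injEq] at h3
      obtain ⟨rfl, rfl⟩ := h3
      obtain ⟨g1, g2, g3, g4⟩ := (B.good a h1).2.2.2 (by simp [hx])
      refine ⟨⟨a, (B.shape (B.ent a)).bump.1⟩, B.mem_V.2 ⟨h1, g2.trans g3⟩,
        B.lt_of_step (hs ▸ g2), (B.shape (B.ent a)).bump.2, ?_, ?_, ?_⟩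
      · simp only [td, blockTD, key, hx]
        rw [if_neg (by omega)]
        simp
      · simp only [pos]
        rw [add_assoc, g4, hs, add_assoc]
      · rintro ⟨b, t⟩ hj h4
        obtain ⟨h5, -⟩ := B.mem_V.1 hj
        simp only [td, blockTD, key] at h4
        split_ifs at h4 with ht
        obtain ⟨y, hy, h6⟩ := Option.map_eq_some_iff.1 h4
        simp only [Prod.mk.injEq] at h6
        obtain ⟨-, rfl⟩ := h6
        have := B.guard a h1 b h5 _ hx hy
        simp only [td, blockTD, key, hy, ht, this]
        simp
    read := by
      rintro ⟨b, s⟩ hi w x h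
      obtain ⟨h1, h2⟩ := B.mem_V.1 hi
      simp only at h1 h2
      simp only [td, blockTD, key] at h
      split_ifs at h with hs
      obtain ⟨x', hx, h3⟩ := Option.map_eq_some_iff.1 h
      simp only [Prod.mk.injEq] at h3
      obtain ⟨rfl, rfl⟩ := h3
      obtain ⟨a, ha, hab, e1, e2, e3⟩ := B.read b h1 _ hx
      obtain ⟨g1, g2, g3, g4⟩ := (B.good a ha).2.2.2 (by simp [e1])
      refine ⟨⟨a, (B.shape (B.ent a)).floor.1⟩, B.mem_V.2 ⟨ha, g3⟩, B.lt_of_row hab, ?_, ?_⟩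
      · simp only [pos, hs]; exact e3
      · simp [td, blockTD, key, e1, e2]
    free := by
      rintro ⟨a, s⟩ hi w h h' j hj hp
      obtain ⟨h1, h2⟩ := B.mem_V.1 hi
      simp only at h1 h2
      rw [B.td_neg] at h
      rw [B.td_symI] at h'
      by_cases hs : s = 0 ∧ (B.rd a).isSome
      · rw [if_pos hs.1, Option.map_eq_none_iff] at h'
        simp [h'] at hs
      · rw [if_neg hs] at h
        by_cases hs' : s = (B.shape (B.ent a)).bump.1 ∧ (B.wr (B.ent a, B.rd a)).isSome
        swap
        · rw [if_neg hs'] at h; simp at h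
        rw [if_pos hs'] at h
        simp only [Option.some.injEq] at h
        obtain ⟨b, hb, hab, e⟩ := B.free a h1 hs'.2
        have hbV : (⟨b, 0⟩ : Ix β) ∈ B.V := B.mem_V.2 ⟨hb, B.len_pos hb⟩
        have : j = ⟨b, 0⟩ := B.pos_injOn hj hbV (by
          rw [hp]; simp only [pos]; rw [e, ← h, hs'.1])
        rw [this]
        exact B.lt_of_row hab
    has_neg := by
      obtain ⟨a, ha, hw⟩ := B.has_neg
      obtain ⟨g1, g2, g3, g4⟩ := (B.good a ha).2.2.2 hw
      refine ⟨⟨a, (B.shape (B.ent a)).bump.1⟩, B.mem_V.2 ⟨ha, g2.trans g3⟩, ?_⟩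
      simp only [td, blockTD, key, hw]
      rw [if_neg (by omega)]
      simp }

/-- A block system that fits into a finite set of at most as many positions as it has tiles
assembles that set. -/
theorem exists_tas [Countable Fam] [Countable S] (X : Set Pos) (v : Pos) (Y : Finset Pos)
    (hY : (Y : Set Pos) = (fun p => p + v) '' X)
    (hsub : ∀ b ∈ B.W, ∀ q ∈ (B.shape (B.ent b)).rel, B.org b + q ∈ Y)
    (hcard : Y.card ≤ ∑ b ∈ B.W, B.len b)
    (K : Finset (Option Fam × Option S)) (hK : ∀ b ∈ B.W, (B.ent b, B.rd b) ∈ K)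
    (L : ℕ) (hL : ∀ b ∈ B.W, B.len b ≤ L) :
    ∃ 𝒯 : TAS, IsRgTAS 𝒯 ∧ DirectedTAS 𝒯 ∧ StrictlySelfAssembles 𝒯 X ∧
      𝒯.tiles.card ≤ K.card * L := by
  classical
  let := B.order
  have himg : B.V.image B.pos = Y := by
    apply Finset.eq_of_subset_of_card_le
    · intro x hx
      obtain ⟨i, hi, rfl⟩ := Finset.mem_image.1 hx
      obtain ⟨h1, h2⟩ := B.mem_V.1 hi
      exact hsub _ h1 _ (B.r_mem h2)
    · rw [Finset.card_image_of_injOn B.pos_injOn, B.card_V]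
      exact hcard
  obtain ⟨𝒯, h1, h2, h3, h4⟩ := B.toPathSystem.exists_tas (X := X) (v := v) (by
    rw [← hY, ← himg, Finset.coe_image]; rfl)
  refine ⟨𝒯, h1, h2, h3, h4.trans ?_⟩
  have : B.toPathSystem.V.image B.toPathSystem.td ⊆
      (K ×ˢ Finset.range L).image fun q => blockTD B.shape B.wr B.ex q.1 q.2 := by
    intro x hx
    obtain ⟨i, hi, rfl⟩ := Finset.mem_image.1 hx
    obtain ⟨h5, h6⟩ := B.mem_V.1 hi
    exact Finset.mem_image.2 ⟨(B.key i.blk, i.step), Finset.mem_product.2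
      ⟨hK _ h5, Finset.mem_range.2 (h6.trans_le (hL _ h5))⟩, rfl⟩
  refine (Finset.card_le_card this).trans (Finset.card_image_le.trans ?_)
  rw [Finset.card_product, Finset.card_range]

end BlockSystem

/-- Quarter turn, which turns the coordinates of the second stage into absolute directions. -/
def mp (σ : Bool) (q : Pos) : Pos := if σ then (q.2, -q.1) else q

/-- `k` positions upwards from `(x, a)`. -/
def up (x a : ℤ) (k : ℕ) : List Pos := (List.range k).map fun i => (x, a + i)

/-- `k` positions downwards from `(x, a)`. -/
def dn (x a : ℤ) (k : ℕ) : List Pos := (List.range k).map fun i => (x, a - i)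

/-- The entry families of blocks. The flag `σ` is the stage, `o` says whether the row runs
backwards. -/
inductive Fam where
  | seed (c : ℕ)
  | sleft
  | cell (σ o st : Bool)
  | cap (σ : Bool)
  | lt (σ cap : Bool)
  | rt1 (f : Bool)
  | rt2
  | turn
  | final
  deriving DecidableEq, Countable

/-- A symbol: stage, orientation of the reading row, digit, diagonal flag, and flags for the first
and the last column. -/
abbrev Sym : Type := Bool × Bool × ℕ × Bool × Bool × Bool

def cellShape (σ o : Bool) : Shape where
  rel := ([(0, 1), (0, 2), (0, 3), (1, 3), (1, 2), (2, 2), (3, 2), (3, 1)] : List Pos).map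
    fun q => mp σ (if o then (2 - q.1, q.2) else q)
  ed := mp σ (if o then (1, 0) else (-1, 0))
  rdDir := mp σ (0, -1)
  ngDir := mp σ (if o then (-1, 0) else (1, 0))
  bump := (3, mp σ (if o then (-1, 0) else (1, 0)))
  floor := (5, mp σ (0, 1))

/-- The height of the blocks of the last row of a stage. -/
def capH (e : ℕ) (σ : Bool) : ℕ := if σ then 4 + e else 4

def capShape (e : ℕ) (σ : Bool) : Shape where
  rel := (up 0 1 (capH e σ) ++ dn 1 (capH e σ) (capH e σ - 1) ++ up 2 2 (capH e σ - 1) ++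
    dn 3 (capH e σ) (capH e σ)).map (mp σ)
  ed := mp σ (-1, 0)
  rdDir := mp σ (0, -1)
  ngDir := mp σ (1, 0)
  bump := (0, 0)
  floor := (0, 0)

def ltShape (h : ℕ) (σ : Bool) : Shape where
  rel := ((-1, 0) :: (up (-2) 0 (3 + h) ++ dn (-1) (2 + h) h)).map (mp σ)
  ed := mp σ (0, 1)
  rdDir := 0
  ngDir := 0
  bump := (0, 0)
  floor := (0, 0)

/-- The shape of the blocks with a given entry family, where `none` is the family of the first
block. -/
def shape (e : ℕ) : Option Fam → Shape
  | none =>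
    { rel := [(0, 0), (1, 0), (1, 1), (0, 1), (0, 2), (0, 3)] ++ dn (-1) 3 (6 + e)
      ed := 0, rdDir := 0, ngDir := 0, bump := (2, (0, 1)), floor := (4, (1, 0)) }
  | some (.seed _) =>
    { rel := up 2 (-6 - e) (8 + e) ++ dn 1 1 (8 + e) ++ up 0 (-6 - e) (7 + e) ++ dn (-1) 0 (7 + e)
      ed := (1, 0), rdDir := 0, ngDir := 0
      bump := (8 + e, (-1, 0)), floor := (22 + 3 * e, (0, 1)) }
  | some .sleft =>
    { rel := up (-2) (-6 - e) (8 + e) ++ [(-1, 1)]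
      ed := (1, 0), rdDir := 0, ngDir := 0, bump := (0, 0), floor := (0, 0) }
  | some (.cell σ o _) => cellShape σ o
  | some (.cap σ) => capShape e σ
  | some (.lt σ c) => ltShape (if c then capH e σ else 1) σ
  | some (.rt1 _) =>
    { rel := [(-1, 0), (0, 0), (1, 0), (1, 1), (0, 1), (0, 2), (0, 3), (-1, 3)]
      ed := (0, 1), rdDir := 0, ngDir := 0, bump := (3, (0, 1)), floor := (5, (1, 0)) }
  | some .rt2 =>
    { rel := ((-1, 0) :: ((List.range 4).flatMap (fun q => if q % 2 = 0
        then (List.range (e + 1)).map (fun i => ((i : ℤ), (q : ℤ)))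
        else (List.range (e + 1)).map (fun i => ((e : ℤ) - i, (q : ℤ))))
            ++ [(-1, 3)])).map (mp true)
      ed := mp true (0, 1), rdDir := 0, ngDir := 0, bump := (0, 0), floor := (0, 0) }
  | some .turn =>
    { rel := [(-1, 0), (0, 0), (1, 0), (1, 1), (0, 1), (0, 2), (0, 3), (0, 4), (1, 4), (1, 3)]
      ed := (0, 1), rdDir := 0, ngDir := 0, bump := (3, (0, 1)), floor := (5, (1, 0)) }
  | some .final =>
    { rel := ((-1, 0) :: (List.range (e + 1)).flatMap (fun x =>
        if x % 2 = 0 then up x 0 (5 + e) else dn x (4 + e) (5 + e))).map (mp true)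
      ed := mp true (0, 1), rdDir := 0, ngDir := 0, bump := (0, 0), floor := (0, 0) }

/-- Does a block with a given entry family read a symbol? -/
def Fam.reads : Fam → Bool
  | .cell _ _ _ => true
  | .cap _ => true
  | _ => false

/-- Does a block with a given entry family write a symbol? -/
def famWrites : Option Fam → Bool
  | none => true
  | some (.seed _) => true
  | some (.cell _ _ _) => true
  | some (.rt1 _) => true
  | some .turn => true
  | _ => false

/-- The possible exit directions. -/
def exits : Option Fam → List (Option Pos)
  | none => [some (-1, 0)]
  | some (.seed _) => [some (-1, 0)]
  | some .sleft => [some (1, 0)]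
  | some (.cell σ o _) => [some (mp σ (0, -1)), some (mp σ (if o then (-1, 0) else (1, 0)))]
  | some (.cap σ) => [some (mp σ (0, -1)), some (mp σ (1, 0))]
  | some (.lt σ _) => [some (mp σ (1, 0))]
  | some (.rt1 _) => [some (-1, 0)]
  | some .rt2 => [some (mp true (-1, 0))]
  | some .turn => [some (0, -1)]
  | some .final => [none]

/-- A family with the same shape, from a finite list. -/
def rep : Option Fam → Option Fam
  | some (.seed _) => some (.seed 0)
  | some (.cell σ o _) => some (.cell σ o false)
  | some (.rt1 _) => some (.rt1 false)
  | k => k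

/-- The representatives of the families. -/
def reps : List (Option Fam) :=
  [none, some (.seed 0), some .sleft, some (.cell false false false), some (.cell false true false),
    some (.cell true false false), some (.cell true true false), some (.cap false),
    some (.cap true), some (.lt false false), some (.lt false true), some (.lt true false),
    some (.lt true true), some (.rt1 false), some .rt2, some .turn, some .final]

theorem fam_cases {P : ℕ → Option Fam → Prop} (h : ∀ e ∈ List.range 4, ∀ k ∈ reps, P e k)
    (hP : ∀ e k, P e (rep k) → P e k) {e : ℕ} (he : e ≤ 3) (k : Option Fam) : P e k := by
  refine hP e k (h e (List.mem_range.2 (by omega)) _ ?_)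
  rcases k with - | f
  · simp [rep, reps]
  rcases f with _ | _ | ⟨_ | _, _ | _, _⟩ | ⟨_ | _⟩ | ⟨_ | _, _ | _⟩ | _ | _ | _ | _ <;>
    simp [rep, reps]

theorem good_shape {e : ℕ} (he : e ≤ 3) (k : Option Fam) (x : Option Pos) (hx : x ∈ exits k) :
    (shape e k).Good k.isSome (k.elim false Fam.reads) (famWrites k) x :=
  fam_cases (P := fun e k => ∀ x ∈ exits k,
    (shape e k).Good k.isSome (k.elim false Fam.reads) (famWrites k) x) (by decide +kernel)
    (by rintro e (- | (_ | _ | _ | _ | _ | _ | _ | _ | _)) h <;> exact h) he k x hx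

/-- The first position of a shape. -/
def firstP (e : ℕ) : Option Fam → Pos
  | none => (0, 0)
  | some (.seed _) => (2, -6 - e)
  | some .sleft => (-2, -6 - e)
  | some (.cell σ o _) => mp σ (if o then (2, 1) else (0, 1))
  | some (.cap σ) => mp σ (0, 1)
  | some (.lt σ _) => mp σ (-1, 0)
  | some (.rt1 _) => (-1, 0)
  | some .rt2 => mp true (-1, 0)
  | some .turn => (-1, 0)
  | some .final => mp true (-1, 0)

/-- The last position of a shape. -/
def lastP (e : ℕ) : Option Fam → Pos
  | none => (-1, -2 - e)
  | some (.seed _) => (-1, -6 - e)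
  | some .sleft => (-1, 1)
  | some (.cell σ o _) => mp σ (if o then (-1, 1) else (3, 1))
  | some (.cap σ) => mp σ (3, 1)
  | some (.lt σ _) => mp σ (-1, 3)
  | some (.rt1 _) => (-1, 3)
  | some .rt2 => mp true (-1, 3)
  | some .turn => (1, 3)
  | some .final => (shape e (some .final)).r ((shape e (some .final)).rel.length - 1)

/-- The position of the pocket of a shape. -/
def pocketP : Option Fam → Pos
  | none => (1, 2)
  | some (.seed _) => (0, 1)
  | some (.cell σ o _) => mp σ (if o then (0, 3) else (2, 3))
  | some (.rt1 _) => (1, 2)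
  | some .turn => (1, 2)
  | _ => 0

/-- The number of positions of a shape. -/
def lenP (e : ℕ) : Option Fam → ℕ
  | none => 12 + e
  | some (.seed _) => 30 + 4 * e
  | some .sleft => 9 + e
  | some (.cell _ _ _) => 8
  | some (.cap σ) => 4 * capH e σ - 2
  | some (.lt σ c) => 4 + 2 * (if c then capH e σ else 1)
  | some (.rt1 _) => 8
  | some .rt2 => 2 + 4 * (e + 1)
  | some .turn => 10
  | some .final => 1 + (e + 1) * (5 + e)

theorem shape_first {e : ℕ} (he : e ≤ 3) (k : Option Fam) : (shape e k).r 0 = firstP e k :=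
  fam_cases (P := fun e k => (shape e k).r 0 = firstP e k) (by decide +kernel)
    (by rintro e (- | (_ | _ | _ | _ | _ | _ | _ | _ | _)) h <;> exact h) he k

theorem shape_length {e : ℕ} (he : e ≤ 3) (k : Option Fam) :
    (shape e k).rel.length = lenP e k :=
  fam_cases (P := fun e k => (shape e k).rel.length = lenP e k) (by decide +kernel)
    (by rintro e (- | (_ | _ | _ | _ | _ | _ | _ | _ | _)) h <;> exact h) he k

theorem shape_last {e : ℕ} (he : e ≤ 3) (k : Option Fam) :
    (shape e k).r ((shape e k).rel.length - 1) = lastP e k :=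
  fam_cases (P := fun e k => (shape e k).r ((shape e k).rel.length - 1) = lastP e k)
      (by decide +kernel)
    (by rintro e (- | (_ | _ | _ | _ | _ | _ | _ | _ | _)) h <;> exact h) he k

theorem shape_bump {e : ℕ} (he : e ≤ 3) (k : Option Fam) (hk : famWrites k) :
    (shape e k).r (shape e k).bump.1 + (shape e k).bump.2 = pocketP k :=
  fam_cases (P := fun e k => famWrites k →
    (shape e k).r (shape e k).bump.1 + (shape e k).bump.2 = pocketP k) (by decide +kernel)
    (by rintro e (- | (_ | _ | _ | _ | _ | _ | _ | _ | _)) h <;> exact h) he k hk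

/-- A description of the positions of a shape. -/
def Desc (e : ℕ) : Option Fam → ℤ → ℤ → Prop
  | none, x, y => (x = 0 ∧ 0 ≤ y ∧ y ≤ 3) ∨ (x = 1 ∧ 0 ≤ y ∧ y ≤ 1) ∨ (x = -1 ∧ -2 - e ≤ y ∧ y ≤ 3)
  | some (.seed _), x, y => -1 ≤ x ∧ x ≤ 2 ∧ -6 - e ≤ y ∧ y ≤ 1 ∧ (x ≤ 0 → y ≤ 0)
  | some .sleft, x, y => (x = -2 ∧ -6 - e ≤ y ∧ y ≤ 1) ∨ (x = -1 ∧ y = 1)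
  | some (.cell _ o _), x, y => 1 ≤ y ∧ y ≤ 3 ∧ (if o then -1 ≤ x ∧ x ≤ 2 ∧
      (x = 1 → 2 ≤ y) ∧ (x = 0 → y = 2) ∧ (x = -1 → y ≤ 2) else 0 ≤ x ∧ x ≤ 3 ∧
      (x = 1 → 2 ≤ y) ∧ (x = 2 → y = 2) ∧ (x = 3 → y ≤ 2))
  | some (.cap σ), x, y => 0 ≤ x ∧ x ≤ 3 ∧ 1 ≤ y ∧ y ≤ capH e σ ∧ (x = 1 → 2 ≤ y) ∧ (x = 2 → 2 ≤ y)
  | some (.lt σ c), x, y => -2 ≤ x ∧ x ≤ -1 ∧ 0 ≤ y ∧ y ≤ 2 + (if c then capH e σ else 1) ∧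
      (x = -1 → y = 0 ∨ 3 ≤ y)
  | some (.rt1 _), x, y => -1 ≤ x ∧ x ≤ 1 ∧ 0 ≤ y ∧ y ≤ 3 ∧ (x = -1 → y = 0 ∨ y = 3) ∧
      (x = 1 → y ≤ 1)
  | some .rt2, x, y => -1 ≤ x ∧ x ≤ e ∧ 0 ≤ y ∧ y ≤ 3 ∧ (x = -1 → y = 0 ∨ y = 3)
  | some .turn, x, y => -1 ≤ x ∧ x ≤ 1 ∧ 0 ≤ y ∧ y ≤ 4 ∧ (x = -1 → y = 0) ∧ (x = 1 → y ≠ 2)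
  | some .final, x, y => -1 ≤ x ∧ x ≤ e ∧ 0 ≤ y ∧ y ≤ 4 + e ∧ (x = -1 → y = 0)

instance (e : ℕ) (k : Option Fam) (x y : ℤ) : Decidable (Desc e k x y) := by
  unfold Desc; split <;> infer_instance

/-- The stage of a shape. -/
def stg : Option Fam → Bool
  | some (.cell σ _ _) => σ
  | some (.cap σ) => σ
  | some (.lt σ _) => σ
  | some .rt2 => true
  | some .final => true
  | _ => false

theorem shape_desc {e : ℕ} (he : e ≤ 3) (k : Option Fam) : ∀ q ∈ (shape e k).rel,
    if stg k then Desc e k (-q.2) q.1 else Desc e k q.1 q.2 :=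
  fam_cases (P := fun e k => ∀ q ∈ (shape e k).rel,
    if stg k then Desc e k (-q.2) q.1 else Desc e k q.1 q.2) (by decide +kernel)
    (by rintro e (- | (_ | _ | _ | _ | _ | _ | _ | _ | _)) h <;> exact h) he k


theorem digit_succ (b q v : ℕ) :
    (v + 1) / b ^ q % b = (v / b ^ q % b + if b ^ q ∣ v + 1 then 1 else 0) % b := by
  rw [Nat.succ_div, Nat.mod_add_mod]

theorem pow_succ_dvd_iff {b : ℕ} (hb : 2 ≤ b) (q v : ℕ) :
    b ^ (q + 1) ∣ v + 1 ↔ b ^ q ∣ v + 1 ∧ v / b ^ q % b + 1 = b := by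
  by_cases h : b ^ q ∣ v + 1
  · have h1 : (v + 1) / b ^ q = v / b ^ q + 1 := by rw [Nat.succ_div, if_pos h]
    have h2 : b ^ (q + 1) ∣ v + 1 ↔ b ∣ v / b ^ q + 1 := by
      rw [← h1, pow_succ, Nat.dvd_div_iff_mul_dvd h]
    rw [h2, Nat.dvd_iff_mod_eq_zero, Nat.add_mod, Nat.mod_eq_of_lt (show 1 < b by omega)]
    have h3 := Nat.mod_lt (v / b ^ q) (show 0 < b by omega)
    simp only [h, true_and]
    generalize v / b ^ q % b = d at *
    constructor
    · intro h4
      by_contra h5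
      rw [Nat.mod_eq_of_lt (by omega)] at h4
      omega
    · intro h4
      rw [h4, Nat.mod_self]
  · simp only [h, false_and, iff_false]
    intro hd
    exact h ((pow_dvd_pow b (Nat.le_succ q)).trans hd)

/-- The parameters of the construction. -/
structure Par where
  n : ℕ
  m : ℕ
  D : ℕ
  e : ℕ
  hn : 2 ≤ n
  hD : 2 ≤ D
  he : e ≤ 3
  hm : m + 1 = n + D
  hp : m ≤ n ^ n

/-- The kinds of blocks. -/
inductive Kind where
  | start | seed | sleft | e1 | rt1 | w1 | lt1 | ltcap1 | cap1 | turn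
  | e2 | rt2 | w2 | lt2 | ltcap2 | cap2 | final
  deriving DecidableEq

open Kind

instance : Fintype Kind where
  elems := {start, seed, sleft, e1, rt1, w1, lt1, ltcap1, cap1, turn, e2, rt2, w2, lt2, ltcap2,
    cap2, final}
  complete := by rintro ⟨⟩ <;> decide

/-- A block is a kind together with a row number and a column number. -/
abbrev Bk : Type := (_ : Kind) × ℕ × ℕ

instance : Countable Bk := by
  have : Countable Kind := Finite.to_countable
  infer_instance

namespace Par

variable (P : Par)

/-- The counter in row `j`. -/
def val (j : ℕ) : ℕ := P.n ^ P.n - P.m + j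

/-- The digit of the counter in row `j` and column `c`. -/
def dig (j c : ℕ) : ℕ := P.val j / P.n ^ (P.n - 1 - c) % P.n

def symE1 (j c : ℕ) : Sym :=
  (false, false, P.dig j c, decide (c + 1 = j), decide (c = 0), decide (c + 1 = P.n))

def symW1 (j c : ℕ) : Sym :=
  (false, true, P.dig j c, decide (c = j), decide (c = 0), decide (c + 1 = P.n))

def symE2 (j c : ℕ) : Sym :=
  (true, false, 0, decide (c + P.n + j = P.m), decide (c = 0), decide (c = P.m + 1))

def symW2 (j c : ℕ) : Sym :=
  (true, true, 0, decide (c + P.n + j = P.m), decide (c = 0), decide (c = P.m + 1))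

/-- The entry family of a block. -/
def ent : Kind → ℕ → ℕ → Option Fam
  | start, _, _ => none
  | seed, _, c => some (.seed c)
  | sleft, _, _ => some .sleft
  | e1, j, c => some (.cell false false (decide (c = j)))
  | rt1, j, _ => some (.rt1 (decide (j = P.n)))
  | w1, j, c => some (.cell false true (decide (P.n ^ (P.n - 1 - c) ∣ P.val j + 1)))
  | lt1, _, _ => some (.lt false false)
  | ltcap1, _, _ => some (.lt false true)
  | cap1, _, _ => some (.cap false)
  | turn, _, _ => some .turn
  | e2, _, _ => some (.cell true false false)
  | rt2, _, _ => some .rt2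
  | w2, j, c => some (.cell true true (decide (c + P.n + j + 1 = P.m)))
  | lt2, _, _ => some (.lt true false)
  | ltcap2, _, _ => some (.lt true true)
  | cap2, _, _ => some (.cap true)
  | final, _, _ => some .final

/-- The symbol that a block reads. -/
def rd : Kind → ℕ → ℕ → Option Sym
  | e1, j, c => some (P.symE1 j c)
  | w1, j, c => some (P.symW1 j c)
  | cap1, _, c => some (P.symE1 P.m c)
  | e2, j, c => some (P.symE2 j c)
  | w2, j, c => some (P.symW2 j c)
  | cap2, _, c => some (P.symE2 P.D c)
  | _, _, _ => none

/-- The symbol that is written by a block with a given key. -/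
def wr : Option Fam × Option Sym → Option Sym
  | (none, _) => some (P.symE2 0 (P.m + 1))
  | (some (.seed c), _) => some (P.symE1 0 c)
  | (some (.cell false false st), some (_, _, d, _, u, w)) => some (false, true, d, st, u, w)
  | (some (.cell false true st), some (_, _, d, f, u, w)) =>
    some (false, false, (d + if st then 1 else 0) % P.n, f, u, w)
  | (some (.cell true false _), some (_, _, d, f, u, w)) => some (true, true, d, f, u, w)
  | (some (.cell true true st), some (_, _, d, _, u, w)) => some (true, false, d, st, u, w)
  | (some (.rt1 f), _) => some (true, false, 0, f, false, false)
  | (some .turn, _) => some (true, false, 0, false, true, false)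
  | _ => none

/-- The exit direction and the family of the next block. -/
def ex : Option Fam × Option Sym → Option (Pos × Fam)
  | (none, _) => some ((-1, 0), .seed (P.n - 1))
  | (some (.seed c), _) => some ((-1, 0), if c = 0 then .sleft else .seed (c - 1))
  | (some .sleft, _) => some ((1, 0), .cell false false true)
  | (some (.cell false false _), some (_, _, _, f, _, w)) =>
    if w then some ((0, -1), .rt1 f) else some ((1, 0), .cell false false f)
  | (some (.cell false true st), some (_, _, d, _, u, _)) =>
    if u then some ((0, -1), .lt false (st && decide (d + 1 = P.n)))
    else some ((-1, 0), .cell false true (st && decide (d + 1 = P.n)))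
  | (some (.cell true false st), some (_, _, _, _, _, w)) =>
    if w then some ((-1, 0), .rt2) else some ((0, -1), .cell true false st)
  | (some (.cell true true _), some (_, _, _, f, u, _)) =>
    if u then some ((-1, 0), .lt true f) else some ((0, 1), .cell true true f)
  | (some (.cap σ), some (_, _, _, _, _, w)) =>
    if w then some (mp σ (0, -1), if σ then .final else .turn) else some (mp σ (1, 0), .cap σ)
  | (some (.lt σ c), _) => some (mp σ (1, 0), if c then .cap σ else .cell σ false false)
  | (some (.rt1 _), _) => some ((-1, 0), .cell false true true)
  | (some .rt2, _) => some (mp true (-1, 0), .cell true true false)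
  | (some .turn, _) => some ((0, -1), .cell true false false)
  | _ => none

/-- The coordinates of the second stage. -/
def T2 (x y : ℤ) : Pos := (4 * P.n + y, 4 * P.m + 2 - x)

/-- The origin of a block. -/
def org : Kind → ℕ → ℕ → Pos
  | start, _, _ => (4 * P.n, -4)
  | seed, _, c => (4 * c, 0)
  | sleft, _, _ => (0, 0)
  | e1, j, c => (4 * c, 4 * j)
  | rt1, j, _ => (4 * P.n, 4 * j)
  | w1, j, c => (4 * c, 4 * j + 2)
  | lt1, j, _ => (0, 4 * j + 2)
  | ltcap1, _, _ => (0, 4 * P.m - 2)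
  | cap1, _, c => (4 * c, 4 * P.m)
  | turn, _, _ => (4 * P.n, 4 * P.m)
  | e2, j, c => P.T2 (4 * c) (4 * j)
  | rt2, j, _ => P.T2 (4 * (P.m + 2)) (4 * j)
  | w2, j, c => P.T2 (4 * c) (4 * j + 2)
  | lt2, j, _ => P.T2 0 (4 * j + 2)
  | ltcap2, _, _ => P.T2 0 (4 * P.D - 2)
  | cap2, _, c => P.T2 (4 * c) (4 * P.D)
  | final, _, _ => P.T2 (4 * (P.m + 2)) (4 * P.D)

/-- The number of rows with a block of a given kind. -/
def numJ : Kind → ℕ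
  | e1 => P.m
  | rt1 => P.m
  | w1 => P.m
  | lt1 => P.m - 1
  | e2 => P.D
  | rt2 => P.D
  | w2 => P.D
  | lt2 => P.D - 1
  | _ => 1

/-- The number of blocks of a given kind in each row. -/
def numC : Kind → ℕ
  | seed => P.n
  | e1 => P.n
  | w1 => P.n
  | cap1 => P.n
  | e2 => P.m + 2
  | w2 => P.m + 2
  | cap2 => P.m + 2
  | _ => 1

/-- The major rank of a block along the path. -/
def row : Kind → ℕ → ℤ
  | start, _ => 0
  | seed, _ => 1
  | sleft, _ => 2
  | e1, j => 3 + 4 * j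
  | rt1, j => 4 + 4 * j
  | w1, j => 5 + 4 * j
  | lt1, j => 6 + 4 * j
  | ltcap1, _ => 4 * P.m + 2
  | cap1, _ => 4 * P.m + 3
  | turn, _ => 4 * P.m + 4
  | e2, j => 4 * P.m + 5 + 4 * j
  | rt2, j => 4 * P.m + 6 + 4 * j
  | w2, j => 4 * P.m + 7 + 4 * j
  | lt2, j => 4 * P.m + 8 + 4 * j
  | ltcap2, _ => 4 * P.m + 4 + 4 * P.D
  | cap2, _ => 4 * P.m + 5 + 4 * P.D
  | final, _ => 4 * P.m + 6 + 4 * P.D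

/-- The minor rank of a block along the path. -/
def col : Kind → ℕ → ℤ
  | seed, c => -c
  | w1, c => -c
  | w2, c => -c
  | e1, c => c
  | cap1, c => c
  | e2, c => c
  | cap2, c => c
  | _, _ => 0

/-- The blocks. -/
def W : Finset Bk :=
  Finset.univ.sigma fun k => Finset.range (P.numJ k) ×ˢ Finset.range (P.numC k)

theorem mem_W {k : Kind} {j c : ℕ} : (⟨k, j, c⟩ : Bk) ∈ P.W ↔ j < P.numJ k ∧ c < P.numC k := by
  simp [W]

/-- Consecutive blocks of the path. -/
inductive Suc : Bk → Bk → Prop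
  | start {c} : c + 1 = P.n → Suc ⟨start, 0, 0⟩ ⟨seed, 0, c⟩
  | seed {c} : Suc ⟨seed, 0, c + 1⟩ ⟨seed, 0, c⟩
  | seed0 : Suc ⟨seed, 0, 0⟩ ⟨sleft, 0, 0⟩
  | sleft : Suc ⟨sleft, 0, 0⟩ ⟨e1, 0, 0⟩
  | e1 {j c} : c + 1 < P.n → Suc ⟨e1, j, c⟩ ⟨e1, j, c + 1⟩
  | e1last {j c} : c + 1 = P.n → Suc ⟨e1, j, c⟩ ⟨rt1, j, 0⟩
  | rt1 {j c} : c + 1 = P.n → Suc ⟨rt1, j, 0⟩ ⟨w1, j, c⟩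
  | w1 {j c} : c + 1 < P.n → Suc ⟨w1, j, c + 1⟩ ⟨w1, j, c⟩
  | w1first {j} : j + 1 < P.m → Suc ⟨w1, j, 0⟩ ⟨lt1, j, 0⟩
  | lt1 {j} : Suc ⟨lt1, j, 0⟩ ⟨e1, j + 1, 0⟩
  | w1last {j} : j + 1 = P.m → Suc ⟨w1, j, 0⟩ ⟨ltcap1, 0, 0⟩
  | ltcap1 : Suc ⟨ltcap1, 0, 0⟩ ⟨cap1, 0, 0⟩
  | cap1 {c} : c + 1 < P.n → Suc ⟨cap1, 0, c⟩ ⟨cap1, 0, c + 1⟩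
  | cap1last {c} : c + 1 = P.n → Suc ⟨cap1, 0, c⟩ ⟨turn, 0, 0⟩
  | turn : Suc ⟨turn, 0, 0⟩ ⟨e2, 0, 0⟩
  | e2 {j c} : c < P.m + 1 → Suc ⟨e2, j, c⟩ ⟨e2, j, c + 1⟩
  | e2last {j c} : c = P.m + 1 → Suc ⟨e2, j, c⟩ ⟨rt2, j, 0⟩
  | rt2 {j c} : c = P.m + 1 → Suc ⟨rt2, j, 0⟩ ⟨w2, j, c⟩
  | w2 {j c} : c < P.m + 1 → Suc ⟨w2, j, c + 1⟩ ⟨w2, j, c⟩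
  | w2first {j} : j + 1 < P.D → Suc ⟨w2, j, 0⟩ ⟨lt2, j, 0⟩
  | lt2 {j} : Suc ⟨lt2, j, 0⟩ ⟨e2, j + 1, 0⟩
  | w2last {j} : j + 1 = P.D → Suc ⟨w2, j, 0⟩ ⟨ltcap2, 0, 0⟩
  | ltcap2 : Suc ⟨ltcap2, 0, 0⟩ ⟨cap2, 0, 0⟩
  | cap2 {c} : c < P.m + 1 → Suc ⟨cap2, 0, c⟩ ⟨cap2, 0, c + 1⟩
  | cap2last {c} : c = P.m + 1 → Suc ⟨cap2, 0, c⟩ ⟨final, 0, 0⟩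

theorem suc_exists {k : Kind} {j c : ℕ} (h : (⟨k, j, c⟩ : Bk) ∈ P.W) :
    k = final ∨ ∃ b ∈ P.W, P.Suc ⟨k, j, c⟩ b := by
  have h1 := P.hn
  have h2 := P.hD
  have h3 := P.hm
  rw [mem_W] at h
  cases k <;> simp only [numJ, numC, Nat.lt_one_iff] at h
  case final => exact Or.inl rfl
  all_goals right
  case start =>
    obtain ⟨rfl, rfl⟩ := h
    exact ⟨⟨seed, 0, P.n - 1⟩, P.mem_W.2 ⟨by simp [numJ], by simp only [numC]; omega⟩,
        .start (by omega)⟩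
  case seed =>
    obtain ⟨rfl, h⟩ := h
    rcases c with - | c
    · exact ⟨_, P.mem_W.2 ⟨by simp [numJ], by simp [numC]⟩, .seed0⟩
    · exact ⟨_, P.mem_W.2 ⟨by simp [numJ], by simp only [numC]; omega⟩, .seed⟩
  case sleft =>
    obtain ⟨rfl, rfl⟩ := h
    exact ⟨_, P.mem_W.2 ⟨by simp only [numJ]; omega, by simp only [numC]; omega⟩, .sleft⟩
  case e1 =>
    by_cases hc : c + 1 < P.n
    · exact ⟨_, P.mem_W.2 ⟨h.1, hc⟩, .e1 hc⟩
    · exact ⟨_, P.mem_W.2 ⟨h.1, by simp [numC]⟩, .e1last (by omega)⟩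
  case rt1 =>
    obtain ⟨h, rfl⟩ := h
    exact ⟨⟨w1, j, P.n - 1⟩, P.mem_W.2 ⟨h, by simp only [numC]; omega⟩, .rt1 (by omega)⟩
  case w1 =>
    rcases c with - | c
    · by_cases hj : j + 1 < P.m
      · exact ⟨_, P.mem_W.2 ⟨by simp only [numJ]; omega, by simp [numC]⟩, .w1first hj⟩
      · exact ⟨_, P.mem_W.2 ⟨by simp [numJ], by simp [numC]⟩, .w1last (by omega)⟩
    · exact ⟨_, P.mem_W.2 ⟨h.1, by simp only [numC]; omega⟩, .w1 h.2⟩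
  case lt1 =>
    obtain ⟨h, rfl⟩ := h
    exact ⟨_, P.mem_W.2 ⟨by simp only [numJ]; omega, by simp only [numC]; omega⟩, .lt1⟩
  case ltcap1 =>
    obtain ⟨rfl, rfl⟩ := h
    exact ⟨_, P.mem_W.2 ⟨by simp [numJ], by simp only [numC]; omega⟩, .ltcap1⟩
  case cap1 =>
    obtain ⟨rfl, h⟩ := h
    by_cases hc : c + 1 < P.n
    · exact ⟨_, P.mem_W.2 ⟨by simp [numJ], hc⟩, .cap1 hc⟩
    · exact ⟨_, P.mem_W.2 ⟨by simp [numJ], by simp [numC]⟩, .cap1last (by omega)⟩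
  case turn =>
    obtain ⟨rfl, rfl⟩ := h
    exact ⟨_, P.mem_W.2 ⟨by simp only [numJ]; omega, by simp only [numC]; omega⟩, .turn⟩
  case e2 =>
    by_cases hc : c < P.m + 1
    · exact ⟨_, P.mem_W.2 ⟨h.1, by simp only [numC]; omega⟩, .e2 hc⟩
    · exact ⟨_, P.mem_W.2 ⟨h.1, by simp [numC]⟩, .e2last (by omega)⟩
  case rt2 =>
    obtain ⟨h, rfl⟩ := h
    exact ⟨⟨w2, j, P.m + 1⟩, P.mem_W.2 ⟨h, by simp only [numC]; omega⟩, .rt2 rfl⟩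
  case w2 =>
    rcases c with - | c
    · by_cases hj : j + 1 < P.D
      · exact ⟨_, P.mem_W.2 ⟨by simp only [numJ]; omega, by simp [numC]⟩, .w2first hj⟩
      · exact ⟨_, P.mem_W.2 ⟨by simp [numJ], by simp [numC]⟩, .w2last (by omega)⟩
    · exact ⟨_, P.mem_W.2 ⟨h.1, by simp only [numC]; omega⟩, .w2 (by omega)⟩
  case lt2 =>
    obtain ⟨h, rfl⟩ := h
    exact ⟨_, P.mem_W.2 ⟨by simp only [numJ]; omega, by simp only [numC]; omega⟩, .lt2⟩
  case ltcap2 =>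
    obtain ⟨rfl, rfl⟩ := h
    exact ⟨_, P.mem_W.2 ⟨by simp [numJ], by simp only [numC]; omega⟩, .ltcap2⟩
  case cap2 =>
    obtain ⟨rfl, h⟩ := h
    by_cases hc : c < P.m + 1
    · exact ⟨_, P.mem_W.2 ⟨by simp [numJ], by simp only [numC]; omega⟩, .cap2 hc⟩
    · exact ⟨_, P.mem_W.2 ⟨by simp [numJ], by simp [numC]⟩, .cap2last (by omega)⟩

theorem pre_exists {k : Kind} {j c : ℕ} (h : (⟨k, j, c⟩ : Bk) ∈ P.W) :
    (⟨k, j, c⟩ : Bk) = ⟨start, 0, 0⟩ ∨ ∃ a ∈ P.W, P.Suc a ⟨k, j, c⟩ := by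
  have h1 := P.hn
  have h2 := P.hD
  have h3 := P.hm
  rw [mem_W] at h
  cases k <;> simp only [numJ, numC, Nat.lt_one_iff] at h
  case start =>
    obtain ⟨rfl, rfl⟩ := h
    exact Or.inl rfl
  all_goals right
  case seed =>
    obtain ⟨rfl, h⟩ := h
    by_cases hc : c + 1 = P.n
    · exact ⟨_, P.mem_W.2 ⟨by simp [numJ], by simp [numC]⟩, .start hc⟩
    · exact ⟨_, P.mem_W.2 ⟨by simp [numJ], by simp only [numC]; omega⟩, .seed⟩
  case sleft =>
    obtain ⟨rfl, rfl⟩ := h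
    exact ⟨_, P.mem_W.2 ⟨by simp [numJ], by simp only [numC]; omega⟩, .seed0⟩
  case e1 =>
    rcases c with - | c
    · rcases j with - | j
      · exact ⟨_, P.mem_W.2 ⟨by simp [numJ], by simp [numC]⟩, .sleft⟩
      · exact ⟨_, P.mem_W.2 ⟨by simp only [numJ]; omega, by simp [numC]⟩, .lt1⟩
    · exact ⟨_, P.mem_W.2 ⟨h.1, by simp only [numC]; omega⟩, .e1 h.2⟩
  case rt1 =>
    obtain ⟨h, rfl⟩ := h
    exact ⟨⟨e1, j, P.n - 1⟩, P.mem_W.2 ⟨h, by simp only [numC]; omega⟩, .e1last (by omega)⟩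
  case w1 =>
    by_cases hc : c + 1 < P.n
    · exact ⟨_, P.mem_W.2 ⟨h.1, hc⟩, .w1 hc⟩
    · exact ⟨_, P.mem_W.2 ⟨h.1, by simp [numC]⟩, .rt1 (by omega)⟩
  case lt1 =>
    obtain ⟨h, rfl⟩ := h
    exact ⟨_, P.mem_W.2 ⟨by simp only [numJ]; omega, by simp only [numC]; omega⟩,
      .w1first (by omega)⟩
  case ltcap1 =>
    obtain ⟨rfl, rfl⟩ := h
    exact ⟨⟨w1, P.m - 1, 0⟩, P.mem_W.2 ⟨by simp only [numJ]; omega, by simp only [numC]; omega⟩,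
      .w1last (by omega)⟩
  case cap1 =>
    obtain ⟨rfl, h⟩ := h
    rcases c with - | c
    · exact ⟨_, P.mem_W.2 ⟨by simp [numJ], by simp [numC]⟩, .ltcap1⟩
    · exact ⟨_, P.mem_W.2 ⟨by simp [numJ], by simp only [numC]; omega⟩, .cap1 h⟩
  case turn =>
    obtain ⟨rfl, rfl⟩ := h
    exact ⟨⟨cap1, 0, P.n - 1⟩, P.mem_W.2 ⟨by simp [numJ], by simp only [numC]; omega⟩,
      .cap1last (by omega)⟩
  case e2 =>
    rcases c with - | c
    · rcases j with - | j
      · exact ⟨_, P.mem_W.2 ⟨by simp [numJ], by simp [numC]⟩, .turn⟩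
      · exact ⟨_, P.mem_W.2 ⟨by simp only [numJ]; omega, by simp [numC]⟩, .lt2⟩
    · exact ⟨_, P.mem_W.2 ⟨h.1, by simp only [numC]; omega⟩, .e2 (by omega)⟩
  case rt2 =>
    obtain ⟨h, rfl⟩ := h
    exact ⟨⟨e2, j, P.m + 1⟩, P.mem_W.2 ⟨h, by simp only [numC]; omega⟩, .e2last rfl⟩
  case w2 =>
    by_cases hc : c < P.m + 1
    · exact ⟨_, P.mem_W.2 ⟨h.1, by simp only [numC]; omega⟩, .w2 hc⟩
    · exact ⟨_, P.mem_W.2 ⟨h.1, by simp [numC]⟩, .rt2 (by omega)⟩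
  case lt2 =>
    obtain ⟨h, rfl⟩ := h
    exact ⟨_, P.mem_W.2 ⟨by simp only [numJ]; omega, by simp only [numC]; omega⟩,
      .w2first (by omega)⟩
  case ltcap2 =>
    obtain ⟨rfl, rfl⟩ := h
    exact ⟨⟨w2, P.D - 1, 0⟩, P.mem_W.2 ⟨by simp only [numJ]; omega, by simp only [numC]; omega⟩,
      .w2last (by omega)⟩
  case cap2 =>
    obtain ⟨rfl, h⟩ := h
    rcases c with - | c
    · exact ⟨_, P.mem_W.2 ⟨by simp [numJ], by simp [numC]⟩, .ltcap2⟩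
    · exact ⟨_, P.mem_W.2 ⟨by simp [numJ], by simp only [numC]; omega⟩, .cap2 (by omega)⟩
  case final =>
    obtain ⟨rfl, rfl⟩ := h
    exact ⟨⟨cap2, 0, P.m + 1⟩, P.mem_W.2 ⟨by simp [numJ], by simp only [numC]; omega⟩,
      .cap2last rfl⟩

/-- A writing block and the block that reads its symbol. -/
inductive Lnk : Bk → Bk → Prop
  | start {c} : c = P.m + 1 → Lnk ⟨start, 0, 0⟩ ⟨e2, 0, c⟩
  | seed {c} : Lnk ⟨seed, 0, c⟩ ⟨e1, 0, c⟩
  | e1 {j c} : Lnk ⟨e1, j, c⟩ ⟨w1, j, c⟩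
  | rt1 {j c} : c + j = P.m → 1 ≤ c → Lnk ⟨rt1, j, 0⟩ ⟨e2, 0, c⟩
  | w1 {j c} : c < P.n → Lnk ⟨w1, j, c⟩ ⟨e1, j + 1, c⟩
  | w1last {j c} : c < P.n → j + 1 = P.m → Lnk ⟨w1, j, c⟩ ⟨cap1, 0, c⟩
  | turn : Lnk ⟨turn, 0, 0⟩ ⟨e2, 0, 0⟩
  | e2 {j c} : Lnk ⟨e2, j, c⟩ ⟨w2, j, c⟩
  | w2 {j c} : Lnk ⟨w2, j, c⟩ ⟨e2, j + 1, c⟩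
  | w2last {j c} : j + 1 = P.D → Lnk ⟨w2, j, c⟩ ⟨cap2, 0, c⟩

theorem reader_exists {k : Kind} {j c : ℕ} (h : (⟨k, j, c⟩ : Bk) ∈ P.W)
    (hw : (P.wr (P.ent k j c, P.rd k j c)).isSome) : ∃ b ∈ P.W, P.Lnk ⟨k, j, c⟩ b := by
  have h1 := P.hn
  have h2 := P.hD
  have h3 := P.hm
  rw [mem_W] at h
  cases k <;> simp only [numJ, numC, Nat.lt_one_iff] at h <;>
    first | (simp [wr, ent] at hw; done) | skip
  case start =>
    obtain ⟨rfl, rfl⟩ := h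
    exact ⟨_, P.mem_W.2 ⟨by simp only [numJ]; omega, by simp [numC]⟩, .start rfl⟩
  case seed =>
    obtain ⟨rfl, h⟩ := h
    exact ⟨_, P.mem_W.2 ⟨by simp only [numJ]; omega, h⟩, .seed⟩
  case e1 => exact ⟨_, P.mem_W.2 h, .e1⟩
  case rt1 =>
    obtain ⟨h, rfl⟩ := h
    exact ⟨⟨e2, 0, P.m - j⟩, P.mem_W.2 ⟨by simp only [numJ]; omega, by simp only [numC]; omega⟩,
      .rt1 (by omega) (by omega)⟩
  case w1 =>
    by_cases hj : j + 1 < P.m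
    · exact ⟨_, P.mem_W.2 ⟨hj, h.2⟩, .w1 h.2⟩
    · exact ⟨_, P.mem_W.2 ⟨by simp [numJ], h.2⟩, .w1last h.2 (by omega)⟩
  case turn =>
    obtain ⟨rfl, rfl⟩ := h
    exact ⟨_, P.mem_W.2 ⟨by simp only [numJ]; omega, by simp [numC]⟩, .turn⟩
  case e2 => exact ⟨_, P.mem_W.2 h, .e2⟩
  case w2 =>
    by_cases hj : j + 1 < P.D
    · exact ⟨_, P.mem_W.2 ⟨hj, h.2⟩, .w2⟩
    · exact ⟨_, P.mem_W.2 ⟨by simp [numJ], h.2⟩, .w2last (by omega)⟩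

theorem writer_exists {k : Kind} {j c : ℕ} (h : (⟨k, j, c⟩ : Bk) ∈ P.W)
    (hr : (P.rd k j c).isSome) : ∃ a ∈ P.W, P.Lnk a ⟨k, j, c⟩ := by
  have h1 := P.hn
  have h2 := P.hD
  have h3 := P.hm
  rw [mem_W] at h
  cases k <;> simp only [numJ, numC, Nat.lt_one_iff] at h <;>
    first | (simp [rd] at hr; done) | skip
  case e1 =>
    rcases j with - | j
    · exact ⟨_, P.mem_W.2 ⟨by simp [numJ], h.2⟩, .seed⟩
    · exact ⟨_, P.mem_W.2 ⟨by simp only [numJ]; omega, h.2⟩, .w1 h.2⟩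
  case w1 => exact ⟨_, P.mem_W.2 h, .e1⟩
  case cap1 =>
    obtain ⟨rfl, h⟩ := h
    exact ⟨⟨w1, P.m - 1, c⟩, P.mem_W.2 ⟨by simp only [numJ]; omega, h⟩, .w1last h (by omega)⟩
  case e2 =>
    rcases j with - | j
    · by_cases hc : c = P.m + 1
      · exact ⟨_, P.mem_W.2 ⟨by simp [numJ], by simp [numC]⟩, .start hc⟩
      · rcases c with - | c
        · exact ⟨_, P.mem_W.2 ⟨by simp [numJ], by simp [numC]⟩, .turn⟩
        · exact ⟨⟨rt1, P.m - (c + 1), 0⟩, P.mem_W.2 ⟨by simp only [numJ]; omega, by simp [numC]⟩,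
            .rt1 (by omega) (by omega)⟩
    · exact ⟨_, P.mem_W.2 ⟨by simp only [numJ]; omega, h.2⟩, .w2⟩
  case w2 => exact ⟨_, P.mem_W.2 h, .e2⟩
  case cap2 =>
    obtain ⟨rfl, h⟩ := h
    exact ⟨⟨w2, P.D - 1, c⟩, P.mem_W.2 ⟨by simp only [numJ]; omega, h⟩, .w2last (by omega)⟩

end Par
end TA

namespace TA
open Kind
namespace Par

variable (P : Par)

theorem dvd_val_iff {j : ℕ} (hj : j < P.m) : P.n ^ P.n ∣ P.val j + 1 ↔ j + 1 = P.m := by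
  have h := P.hp
  unfold val
  constructor
  · intro h1
    have := Nat.le_of_dvd (by omega) h1
    omega
  · intro h1
    rw [show P.n ^ P.n - P.m + j + 1 = P.n ^ P.n by omega]

theorem carry {j c : ℕ} (hc : c < P.n) : (decide (P.n ^ (P.n - 1 - c) ∣ P.val j + 1) &&
    decide (P.dig j c + 1 = P.n)) = decide (P.n ^ (P.n - c) ∣ P.val j + 1) := by
  rw [show P.n - c = P.n - 1 - c + 1 by omega, ← Bool.decide_and, decide_eq_decide]
  exact (pow_succ_dvd_iff P.hn _ _).symm

theorem dig_succ (j c : ℕ) : P.dig (j + 1) c =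
    (P.dig j c + if P.n ^ (P.n - 1 - c) ∣ P.val j + 1 then 1 else 0) % P.n :=
  digit_succ _ _ _

theorem Suc.rank_lt {P : Par} {a b : Bk} (h : P.Suc a b) (ha : a ∈ P.W) :
    P.row a.1 a.2.1 < P.row b.1 b.2.1 ∨
      P.row a.1 a.2.1 = P.row b.1 b.2.1 ∧ col a.1 a.2.2 < col b.1 b.2.2 := by
  have h1 := P.hn
  have h2 := P.hD
  have h3 := P.hm
  rcases a with ⟨ka, ja, ca⟩
  rcases b with ⟨kb, jb, cb⟩
  rw [mem_W] at ha
  cases h <;> simp only [row, col, numJ, numC] at ha ⊢ <;> push_cast <;> grind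

theorem Lnk.rank_lt {P : Par} {a b : Bk} (h : P.Lnk a b) (ha : a ∈ P.W) :
    P.row a.1 a.2.1 < P.row b.1 b.2.1 ∨
      P.row a.1 a.2.1 = P.row b.1 b.2.1 ∧ col a.1 a.2.2 < col b.1 b.2.2 := by
  have h1 := P.hn
  have h2 := P.hD
  have h3 := P.hm
  rcases a with ⟨ka, ja, ca⟩
  rcases b with ⟨kb, jb, cb⟩
  rw [mem_W] at ha
  cases h <;> simp only [row, col, numJ, numC] at ha ⊢ <;> push_cast <;> grind

theorem Suc.geom {P : Par} {a b : Bk} (h : P.Suc a b) :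
    P.org b.1 b.2.1 b.2.2 + firstP P.e (P.ent b.1 b.2.1 b.2.2) =
      P.org a.1 a.2.1 a.2.2 + lastP P.e (P.ent a.1 a.2.1 a.2.2) -
        (shape P.e (P.ent b.1 b.2.1 b.2.2)).ed := by
  have h3 := P.hm
  rcases a with ⟨ka, ja, ca⟩
  rcases b with ⟨kb, jb, cb⟩
  cases h <;>
    simp only [org, firstP, lastP, ent, shape, cellShape, capShape, ltShape, mp, T2,
      Prod.mk_add_mk, Prod.mk_sub_mk, Prod.mk.injEq, Bool.false_eq_true, if_false, if_true] <;>
    push_cast <;> grind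

theorem Suc.ex_eq {P : Par} {a b : Bk} (h : P.Suc a b) (ha : a ∈ P.W) :
    P.ex (P.ent a.1 a.2.1 a.2.2, P.rd a.1 a.2.1 a.2.2) =
      (P.ent b.1 b.2.1 b.2.2).map fun f => (-(shape P.e (some f)).ed, f) := by
  have h1 := P.hn
  have h2 := P.hD
  have h3 := P.hm
  rcases a with ⟨ka, ja, ca⟩
  rcases b with ⟨kb, jb, cb⟩
  rw [mem_W] at ha
  cases h <;> simp only [numJ, numC] at ha
  case start hc => simp [ex, ent, shape, ← hc]
  case e1 hc => simp [ex, ent, rd, symE1, shape, cellShape, mp, hc.ne]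
  case e1last hc => simp [ex, ent, rd, symE1, shape, cellShape, mp, hc, eq_comm]
  case rt1 hc => simp [ex, ent, shape, cellShape, mp, show P.n - 1 - cb = 0 by omega]
  case w1 hc =>
    simp only [ex, ent, rd, symW1, P.carry ha.2]
    simp [shape, cellShape, mp, show P.n - (cb + 1) = P.n - 1 - cb by omega]
  case w1first hj =>
    have h := P.carry (j := ja) ha.2
    simp only [Nat.sub_zero] at h
    simp only [ex, ent, rd, symW1, Nat.sub_zero, h, P.dvd_val_iff ha.1]
    simp [shape, ltShape, mp, hj.ne]
  case w1last hj =>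
    have h := P.carry (j := ja) ha.2
    simp only [Nat.sub_zero] at h
    simp only [ex, ent, rd, symW1, Nat.sub_zero, h, P.dvd_val_iff ha.1]
    simp [shape, ltShape, mp, hj]
  case cap1 hc => simp [ex, ent, rd, symE1, shape, capShape, mp, hc.ne]
  case cap1last hc => simp [ex, ent, rd, symE1, shape, mp, hc]
  case e2 hc => simp [ex, ent, rd, symE2, shape, cellShape, mp, hc.ne]
  case e2last hc => simp [ex, ent, rd, symE2, shape, mp, hc]
  case rt2 hc => simp [ex, ent, shape, cellShape, mp, show cb + P.n + ja + 1 ≠ P.m by omega]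
  case w2 hc =>
    simp [ex, ent, rd, symW2, shape, cellShape, mp,
      show cb + 1 + P.n + ja = cb + P.n + ja + 1 by omega]
  case w2first hj =>
    simp [ex, ent, rd, symW2, shape, ltShape, mp, show P.n + ja ≠ P.m by omega]
  case w2last hj =>
    simp [ex, ent, rd, symW2, shape, ltShape, mp, show P.n + ja = P.m by omega]
  case cap2 hc => simp [ex, ent, rd, symE2, shape, capShape, mp, hc.ne]
  case cap2last hc => simp [ex, ent, rd, symE2, shape, mp, hc]
  all_goals simp [ex, ent, shape, cellShape, capShape, ltShape, mp]

theorem Lnk.geom {P : Par} {a b : Bk} (h : P.Lnk a b) :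
    P.org b.1 b.2.1 b.2.2 + firstP P.e (P.ent b.1 b.2.1 b.2.2) =
      P.org a.1 a.2.1 a.2.2 + pocketP (P.ent a.1 a.2.1 a.2.2) := by
  have h3 := P.hm
  rcases a with ⟨ka, ja, ca⟩
  rcases b with ⟨kb, jb, cb⟩
  cases h <;>
    simp only [org, firstP, pocketP, ent, mp, T2,
      Prod.mk_add_mk, Prod.mk.injEq, Bool.false_eq_true, if_false, if_true] <;>
    push_cast <;> grind

theorem Lnk.wr_eq {P : Par} {a b : Bk} (h : P.Lnk a b) :
    P.wr (P.ent a.1 a.2.1 a.2.2, P.rd a.1 a.2.1 a.2.2) = P.rd b.1 b.2.1 b.2.2 := by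
  have h1 := P.hn
  have h2 := P.hD
  have h3 := P.hm
  rcases a with ⟨ka, ja, ca⟩
  rcases b with ⟨kb, jb, cb⟩
  cases h
  case start hc => simp only [wr, ent, rd, hc]
  case rt1 hc hc' =>
    simp [wr, ent, rd, symE2, show cb ≠ 0 by omega, show cb ≠ P.m + 1 by omega,
      show cb + P.n = P.m ↔ ja = P.n by omega]
  case w1 hc =>
    simp [wr, ent, rd, symW1, symE1, P.dig_succ]
  case w1last hj hc =>
    simp [wr, ent, rd, symW1, symE1, P.dig_succ, ← hj]
  case turn => simp [wr, ent, rd, symE2, show P.n ≠ P.m by omega]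
  case w2 =>
    simp [wr, ent, rd, symE2, symW2, add_assoc]
  case w2last hj =>
    simp [wr, ent, rd, symE2, symW2, ← hj, add_assoc]
  all_goals simp [wr, ent, rd, symE1, symW1, symE2, symW2]

end Par

/-- The repulsive side of the reader of a symbol. -/
def ngd (s : Sym) : Pos := mp s.1 (if s.2.1 then (-1, 0) else (1, 0))

/-- The reading side of the reader of a symbol. -/
def rdd (s : Sym) : Pos := mp s.1 (0, -1)

open Kind
namespace Par

variable (P : Par)

theorem rd_isSome (k : Kind) (j c : ℕ) :
    (P.rd k j c).isSome = (P.ent k j c).elim false Fam.reads := by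
  cases k <;> rfl

theorem wr_isSome (k : Kind) (j c : ℕ) :
    (P.wr (P.ent k j c, P.rd k j c)).isSome = famWrites (P.ent k j c) := by
  cases k <;> rfl

theorem ex_mem_exits (k : Kind) (j c : ℕ) :
    (P.ex (P.ent k j c, P.rd k j c)).map Prod.fst ∈ exits (P.ent k j c) := by
  cases k <;> simp only [ex, ent, rd, symE1, symE2, symW1, symW2, exits] <;>
    (try split_ifs) <;> simp_all [mp]

theorem wr_dir {k : Kind} {j c : ℕ} {s : Sym} (h : P.wr (P.ent k j c, P.rd k j c) = some s) :
    (shape P.e (P.ent k j c)).bump.2 = -ngd s ∧ (shape P.e (P.ent k j c)).floor.2 = -rdd s := by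
  cases k <;> simp only [wr, ent, rd, symE1, symE2, symW1, symW2, Option.some.injEq,
    reduceCtorEq] at h <;> subst h <;> exact ⟨rfl, rfl⟩

theorem rd_dir {k : Kind} {j c : ℕ} {s : Sym} (h : P.rd k j c = some s) :
    (shape P.e (P.ent k j c)).ngDir = ngd s ∧ (shape P.e (P.ent k j c)).rdDir = rdd s := by
  cases k <;> simp only [rd, symE1, symE2, symW1, symW2, Option.some.injEq,
    reduceCtorEq] at h <;> subst h <;> exact ⟨rfl, rfl⟩

/-- Does a block contain a position? -/
def Cov (k : Kind) (j c : ℕ) (p : Pos) : Prop :=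
  if stg (P.ent k j c) then
    Desc P.e (P.ent k j c) ((P.org k j c).2 - p.2) (p.1 - (P.org k j c).1)
  else Desc P.e (P.ent k j c) (p.1 - (P.org k j c).1) (p.2 - (P.org k j c).2)

theorem cov_of_mem {k : Kind} {j c : ℕ} {q : Pos} (hq : q ∈ (shape P.e (P.ent k j c)).rel) :
    P.Cov k j c (P.org k j c + q) := by
  have := shape_desc P.he _ q hq
  unfold Cov
  split_ifs at this ⊢ <;> simpa using this

set_option maxHeartbeats 0 in
theorem cov_inj {k k' : Kind} {j j' c c' : ℕ} {p : Pos} (hb : (⟨k, j, c⟩ : Bk) ∈ P.W)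
    (hb' : (⟨k', j', c'⟩ : Bk) ∈ P.W) (h : P.Cov k j c p) (h' : P.Cov k' j' c' p) :
    (⟨k, j, c⟩ : Bk) = ⟨k', j', c'⟩ := by
  have h1 := P.hn
  have h2 := P.hD
  have h3 := P.hm
  have h4 := P.he
  rw [mem_W] at hb hb'
  obtain ⟨x, y⟩ := p
  cases k <;> simp only [numJ, numC, Cov, ent, stg, Desc, org, T2, capH, if_true, if_false,
    Bool.false_eq_true, Nat.cast_add, Nat.cast_ofNat] at hb h
  all_goals
    cases k' <;> simp only [numJ, numC, Cov, ent, stg, Desc, org, T2, capH, if_true, if_false,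
      Bool.false_eq_true, Nat.cast_add, Nat.cast_ofNat] at hb' h' <;>
    simp only [Sigma.mk.injEq, reduceCtorEq, false_and, true_and, heq_eq_eq, Prod.mk.injEq]
  all_goals omega

end Par
end TA

namespace TA
open Kind
namespace Par

variable (P : Par)

/-- The side length of the square. -/
def N : ℕ := 4 * P.m + 11 + P.e

theorem cov_bounds {k : Kind} {j c : ℕ} {p : Pos} (hb : (⟨k, j, c⟩ : Bk) ∈ P.W)
    (h : P.Cov k j c p) : -2 ≤ p.1 ∧ p.1 < -2 + P.N ∧ -6 - P.e ≤ p.2 ∧ p.2 < -6 - P.e + P.N := by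
  have h1 := P.hn
  have h2 := P.hD
  have h3 := P.hm
  have h4 := P.he
  rw [mem_W] at hb
  obtain ⟨x, y⟩ := p
  unfold N
  cases k <;> simp only [numJ, numC, Cov, ent, stg, Desc, org, T2, capH, if_true, if_false,
    Bool.false_eq_true, Nat.cast_add, Nat.cast_ofNat] at hb h
  all_goals push_cast
  all_goals omega

theorem suc_step {a b : Bk} (h : P.Suc a b) (ha : a ∈ P.W) :
    (P.row a.1 a.2.1 < P.row b.1 b.2.1 ∨
      P.row a.1 a.2.1 = P.row b.1 b.2.1 ∧ col a.1 a.2.2 < col b.1 b.2.2) ∧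
    ∃ d f, P.ex (P.ent a.1 a.2.1 a.2.2, P.rd a.1 a.2.1 a.2.2) = some (d, f) ∧
      P.ent b.1 b.2.1 b.2.2 = some f ∧ (shape P.e (P.ent b.1 b.2.1 b.2.2)).ed = -d ∧
      P.org b.1 b.2.1 b.2.2 + (shape P.e (P.ent b.1 b.2.1 b.2.2)).r 0 =
        P.org a.1 a.2.1 a.2.2 + (shape P.e (P.ent a.1 a.2.1 a.2.2)).r
          ((shape P.e (P.ent a.1 a.2.1 a.2.2)).rel.length - 1) + d := by
  have hx := h.ex_eq ha
  have hg := h.geom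
  refine ⟨h.rank_lt ha, ?_⟩
  cases hf : P.ent b.1 b.2.1 b.2.2 with
  | none => 
    cases h <;> simp [ent] at hf
  | some f =>
    rw [hf] at hx hg
    refine ⟨_, f, hx, rfl, (neg_neg _).symm, ?_⟩
    rw [shape_first P.he, shape_last P.he, hg, sub_eq_add_neg]

theorem lnk_pocket {a b : Bk} (h : P.Lnk a b)
    (hw : (P.wr (P.ent a.1 a.2.1 a.2.2, P.rd a.1 a.2.1 a.2.2)).isSome) :
    P.org b.1 b.2.1 b.2.2 + (shape P.e (P.ent b.1 b.2.1 b.2.2)).r 0 =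
      P.org a.1 a.2.1 a.2.2 + (shape P.e (P.ent a.1 a.2.1 a.2.2)).r
        (shape P.e (P.ent a.1 a.2.1 a.2.2)).bump.1 +
            (shape P.e (P.ent a.1 a.2.1 a.2.2)).bump.2 := by
  rw [wr_isSome] at hw
  rw [shape_first P.he, h.geom, add_assoc, shape_bump P.he _ hw]

theorem good (b : Bk) : (shape P.e (P.ent b.1 b.2.1 b.2.2)).Good (P.ent b.1 b.2.1 b.2.2).isSome
    (P.rd b.1 b.2.1 b.2.2).isSome (P.wr (P.ent b.1 b.2.1 b.2.2, P.rd b.1 b.2.1 b.2.2)).isSome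
    ((P.ex (P.ent b.1 b.2.1 b.2.2, P.rd b.1 b.2.1 b.2.2)).map Prod.fst) := by
  rw [rd_isSome, wr_isSome]
  exact good_shape P.he _ _ (P.ex_mem_exits _ _ _)

/-- The block system of the construction. -/
def sys : BlockSystem Bk Fam Sym where
  shape := shape P.e
  wr := P.wr
  ex := P.ex
  W := P.W
  ent b := P.ent b.1 b.2.1 b.2.2
  rd b := P.rd b.1 b.2.1 b.2.2
  org b := P.org b.1 b.2.1 b.2.2
  row b := P.row b.1 b.2.1
  col b := col b.1 b.2.2
  b0 := ⟨start, 0, 0⟩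
  b0_mem := P.mem_W.2 ⟨Nat.one_pos, Nat.one_pos⟩
  b0_ent := rfl
  good b _ := P.good b
  pos_inj b hb b' hb' q hq q' hq' h :=
    P.cov_inj hb hb' (P.cov_of_mem hq) (h ▸ P.cov_of_mem hq')
  pred b hb := by
    refine (P.pre_exists hb).imp id ?_
    rintro ⟨a, ha, h⟩
    exact ⟨a, ha, P.suc_step h ha⟩
  succ a ha := by
    refine (P.suc_exists ha).imp (fun h => ?_) ?_
    · obtain ⟨k, j, c⟩ := a
      obtain rfl : k = final := h
      rfl
    · rintro ⟨b, hb, h⟩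
      exact ⟨b, hb, P.suc_step h ha⟩
  det a _ b _ _ h := by rw [rd_isSome, rd_isSome, h]
  guard a _ b _ s h h' := by rw [(P.rd_dir h').1, (P.wr_dir h).1, neg_neg]
  read b hb s h := by
    obtain ⟨a, ha, hl⟩ := P.writer_exists hb (Option.isSome_of_eq_some h)
    have hw := hl.wr_eq.trans h
    refine ⟨a, ha, hl.rank_lt ha, hw, by rw [(P.rd_dir h).2, (P.wr_dir hw).2], ?_⟩
    have hs := Option.isSome_of_eq_some hw
    have hg := ((P.good a).2.2.2 hs).2.2.2
    rw [P.lnk_pocket hl hs, (P.rd_dir h).2, add_assoc,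
        add_assoc, ← add_assoc (Shape.r _ _) _ (rdd s), hg,
      (P.wr_dir hw).2, neg_add_cancel_right]
  free a ha h := by
    obtain ⟨b, hb, hl⟩ := P.reader_exists ha h
    exact ⟨b, hb, hl.rank_lt ha, P.lnk_pocket hl h⟩
  has_neg := ⟨⟨start, 0, 0⟩, P.mem_W.2 ⟨Nat.one_pos, Nat.one_pos⟩, rfl⟩

end Par
end TA

namespace TA
open Kind

instance : DecidableEq (Option Sym) := fun a b => Option.instDecidableEq a b

namespace Par

variable (P : Par)

/-- The number of tiles of the blocks of a given kind. -/
def klen : Kind → ℕ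
  | start => 12 + P.e
  | seed => 30 + 4 * P.e
  | sleft => 9 + P.e
  | ltcap1 => 12
  | cap1 => 14
  | turn => 10
  | lt1 => 6
  | rt2 => 6 + 4 * P.e
  | lt2 => 6
  | ltcap2 => 12 + 2 * P.e
  | cap2 => 14 + 4 * P.e
  | final => 1 + (P.e + 1) * (5 + P.e)
  | _ => 8

theorem len_eq (b : Bk) : P.sys.len b = P.klen b.1 := by
  refine (shape_length P.he _).trans ?_
  obtain ⟨k, j, c⟩ := b
  cases k <;> simp only [sys, ent, lenP, klen, capH, if_true, if_false, Bool.false_eq_true] <;>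
      ring_nf
  all_goals omega

theorem len_le (b : Bk) : P.sys.len b ≤ 42 := by
  rw [len_eq]
  have := P.he
  have : (P.e + 1) * (5 + P.e) ≤ 4 * 8 := Nat.mul_le_mul (by omega) (by omega)
  cases b.1 <;> simp only [klen] <;> omega

theorem sum_kind (f : Kind → ℕ) : ∑ k, f k = f start + (f seed + (f sleft + (f e1 + (f rt1 +
    (f w1 + (f lt1 + (f ltcap1 + (f cap1 + (f turn + (f e2 + (f rt2 + (f w2 + (f lt2 + (f ltcap2 +
    (f cap2 + f final))))))))))))))) :=
  rfl

theorem sum_len : ∑ b ∈ P.sys.W, P.sys.len b = P.N ^ 2 := by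
  have h : ∑ b ∈ P.W, P.klen b.1 = ∑ k, P.numJ k * P.numC k * P.klen k := by
    simp [W, Finset.sum_sigma]
  rw [Finset.sum_congr rfl fun b _ => P.len_eq b]
  refine h.trans ?_
  have h1 := P.hn
  have h2 := P.hD
  have h3 := P.hm
  obtain ⟨n', hn⟩ : ∃ n', P.n = n' + 1 := ⟨P.n - 1, by omega⟩
  obtain ⟨D', hD⟩ : ∃ D', P.D = D' + 1 := ⟨P.D - 1, by omega⟩
  have hm : P.m = n' + D' + 1 := by omega
  simp only [sum_kind, numJ, numC, klen, N, hn, hD, hm, Nat.add_sub_cancel]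
  ring

/-- The positions of the square. -/
noncomputable def square : Finset Pos :=
  Finset.Ico (-2 : ℤ) (-2 + P.N) ×ˢ Finset.Ico (-6 - P.e : ℤ) (-6 - P.e + P.N)

theorem card_square : P.square.card = P.N ^ 2 := by
  simp [square, sq]

theorem coe_square : (P.square : Set Pos) = (fun p => p + (-2, -6 - (P.e : ℤ))) '' SN P.N := by
  ext ⟨x, y⟩
  simp only [square, SN, Finset.coe_product, Finset.coe_Ico, Set.mem_prod, Set.mem_Ico,
    Set.mem_image, Set.mem_ofPred_eq, Prod.exists, Prod.mk_add_mk, Prod.mk.injEq]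
  constructor
  · intro h
    exact ⟨x + 2, y + 6 + P.e, by omega, by omega, by omega⟩
  · rintro ⟨a, b, h, rfl, rfl⟩
    omega

/-- The families of reading blocks. -/
def readFams : Finset (Option Fam) :=
  {some (.cell false false false), some (.cell false false true), some (.cell false true false),
    some (.cell false true true), some (.cell true false false), some (.cell true false true),
    some (.cell true true false), some (.cell true true true), some (.cap false), some (.cap true)}

/-- The families of the other blocks, up to those of the seed row. -/
def plainFams : Finset (Option Fam) :=
  {none, some .sleft, some (.lt false false), some (.lt false true), some (.lt true false),
    some (.lt true true), some (.rt1 false), some (.rt1 true), some .rt2, some .turn, some .final}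

/-- All the keys of blocks. -/
def keys : Finset (Option Fam × Option Sym) :=
  plainFams ×ˢ {none} ∪ (Finset.range P.n).image (fun c => (some (.seed c), none)) ∪
    readFams ×ˢ (Finset.univ ×ˢ Finset.univ ×ˢ Finset.range P.n ×ˢ Finset.univ).image some

theorem card_keys : P.keys.card ≤ 327 * P.n := by
  refine (Finset.card_union_le _ _).trans ?_
  refine (Nat.add_le_add_right (Finset.card_union_le _ _) _).trans ?_
  have h1 : (Finset.image (fun c => ((some (.seed c), none) : Option Fam × Option Sym))
      (Finset.range P.n)).card ≤ P.n := Finset.card_image_le.trans (by simp)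
  have h2 : (Finset.image some ((Finset.univ : Finset Bool) ×ˢ (Finset.univ : Finset Bool) ×ˢ
      Finset.range P.n ×ˢ (Finset.univ : Finset (Bool × Bool × Bool)))).card ≤ 32 * P.n := by
    refine Finset.card_image_le.trans (le_of_eq ?_)
    simp only [Finset.card_product, Finset.card_univ, Fintype.card_bool, Finset.card_range,
      Fintype.card_prod]
    ring
  have h3 : plainFams.card = 11 := rfl
  have h4 : readFams.card = 10 := rfl
  have h5 := P.hn
  rw [Finset.card_product, Finset.card_product, h3, h4, Finset.card_singleton]
  omega

theorem dig_lt (j c : ℕ) : P.dig j c < P.n := Nat.mod_lt _ (by have := P.hn; omega)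

theorem mem_keys {b : Bk} (hb : b ∈ P.W) :
    (P.ent b.1 b.2.1 b.2.2, P.rd b.1 b.2.1 b.2.2) ∈ P.keys := by
  have h1 := P.hn
  obtain ⟨k, j, c⟩ := b
  rw [mem_W] at hb
  have := P.dig_lt
  cases k <;> simp only [keys, ent, rd, symE1, symE2, symW1, symW2, Finset.mem_union,
    Finset.mem_product, Finset.mem_image, numC] at hb ⊢
  case seed => simp [hb]
  case e1 | w1 | cap1 =>
    refine Or.inr ⟨?_, _, ?_, rfl⟩
    · simp [readFams] <;> tauto
    · simp [this]
  case e2 | w2 | cap2 =>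
    refine Or.inr ⟨?_, _, ?_, rfl⟩
    · simp [readFams] <;> tauto
    · simp; omega
  all_goals simp [plainFams] <;> tauto

theorem exists_tas : ∃ 𝒯 : TAS, IsRgTAS 𝒯 ∧ DirectedTAS 𝒯 ∧ StrictlySelfAssembles 𝒯 (SN P.N) ∧
    𝒯.tiles.card ≤ 13734 * P.n := by
  obtain ⟨𝒯, h1, h2, h3, h4⟩ := P.sys.exists_tas (SN P.N) (-2, -6 - (P.e : ℤ)) P.square P.coe_square
    (fun b hb q hq => by
      have := P.cov_bounds hb (P.cov_of_mem hq)
      simp only [square, Finset.mem_product, Finset.mem_Ico]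
      exact ⟨⟨this.1, this.2.1⟩, this.2.2⟩)
    (by rw [sum_len, card_square]) P.keys (fun b hb => P.mem_keys hb) 42 (fun b _ => P.len_le b)
  have := P.card_keys
  exact ⟨𝒯, h1, h2, h3, by omega⟩

end Par

/-- Position `i` of the boustrophedon path through the square of side `N`. -/
def bous (N i : ℕ) : Pos :=
    (if i / N % 2 = 0 then (i % N : ℕ) else (N : ℤ) - 1 - (i % N : ℕ), (i / N : ℕ))

theorem div_mod_succ {N : ℕ} (hN : 0 < N) (i : ℕ) :
    ((i + 1) / N = i / N ∧ (i + 1) % N = i % N + 1 ∧ i % N + 1 < N) ∨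
      ((i + 1) / N = i / N + 1 ∧ (i + 1) % N = 0 ∧ i % N + 1 = N) := by
  have h1 := Nat.div_add_mod i N
  have h2 := Nat.mod_lt i hN
  by_cases h : i % N + 1 < N
  · left
    have h3 : i + 1 = (i % N + 1) + N * (i / N) := by omega
    refine ⟨?_, ?_, h⟩
    · rw [h3, Nat.add_mul_div_left _ _ hN, Nat.div_eq_of_lt h, zero_add]
    · rw [h3, Nat.add_mul_mod_self_left, Nat.mod_eq_of_lt h]
  · right
    have h4 : i % N + 1 = N := by omega
    have h3 : i + 1 = N * (i / N + 1) := by rw [mul_add, mul_one]; omega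
    exact ⟨by rw [h3, Nat.mul_div_cancel_left _ hN], by rw [h3, Nat.mul_mod_right], h4⟩

theorem bous_succ {N : ℕ} (hN : 0 < N) (i : ℕ) :
    (bous N (i + 1) - bous N i = (1, 0) ∧ i / N % 2 = 0 ∧ i % N + 1 < N) ∨
    (bous N (i + 1) - bous N i = (-1, 0) ∧ i / N % 2 = 1 ∧ i % N + 1 < N) ∨
    (bous N (i + 1) - bous N i = (0, 1) ∧ i % N + 1 = N) := by
  have h0 := Nat.mod_two_eq_zero_or_one (i / N)
  rcases div_mod_succ hN i with ⟨h1, h2, h3⟩ | ⟨h1, h2, h3⟩ <;>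
    rcases h0 with h0 | h0 <;>
    simp [bous, h1, h2, h0, Nat.add_mod] <;> omega

theorem bous_inj {N : ℕ} (hN : 0 < N) {i j : ℕ} (h : bous N i = bous N j) : i = j := by
  simp only [bous, Prod.mk.injEq, Nat.cast_inj] at h
  have hi := Nat.mod_lt i hN
  have hj := Nat.mod_lt j hN
  have h1 : i % N = j % N := by
    obtain ⟨h, h'⟩ := h
    rw [h'] at h
    split_ifs at h <;> omega
  rw [← Nat.div_add_mod i N, ← Nat.div_add_mod j N, h.2, h1]

theorem bous_image {N : ℕ} :
    bous N '' (Finset.range (N ^ 2) : Set ℕ) = (fun p => p + (0 : Pos)) '' SN N := by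
  ext ⟨x, y⟩
  simp only [add_zero, Set.image_id', Set.mem_image, SN, Set.mem_ofPred_eq,
      Finset.coe_range, Set.mem_Iio]
  constructor
  · rintro ⟨i, hi, h⟩
    simp only [bous, Prod.mk.injEq] at h
    obtain ⟨rfl, rfl⟩ := h
    have hN : 0 < N := Nat.pos_of_ne_zero (by rintro rfl; simp at hi)
    have h1 := Nat.mod_lt i hN
    have h2 : i / N < N := Nat.div_lt_of_lt_mul (by rwa [← sq])
    generalize i / N = q at *
    generalize i % N = r at *
    split_ifs <;> omega
  · rintro ⟨h1, h2, h3, h4⟩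
    obtain ⟨a, rfl⟩ := Int.eq_ofNat_of_zero_le h1
    obtain ⟨b, rfl⟩ := Int.eq_ofNat_of_zero_le h3
    obtain ⟨r, hr, har⟩ : ∃ r : ℕ, r < N ∧ (a : ℤ) =
        if b % 2 = 0 then (r : ℤ) else (N : ℤ) - 1 - r := by
      by_cases hb : b % 2 = 0
      · exact ⟨a, by omega, by simp [hb]⟩
      · exact ⟨N - 1 - a, by omega, by simp only [hb, if_false]; omega⟩
    have h5 : (b * N + r) / N = b := by
      rw [mul_comm, Nat.mul_add_div (by omega), Nat.div_eq_of_lt hr, add_zero]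
    have h6 : (b * N + r) % N = r := by
      rw [mul_comm, Nat.mul_add_mod, Nat.mod_eq_of_lt hr]
    refine ⟨b * N + r, ?_, ?_⟩
    · have : (b + 1) * N ≤ N * N := Nat.mul_le_mul_right _ (by omega)
      rw [sq]; rw [add_mul] at this; omega
    · simp only [bous, h5, h6, ← har]

/-- The tile at step `i` of the boustrophedon path. -/
def bousTD (N i : ℕ) : TD ℕ ℕ where
  inp := if i = 0 then none else some (bous N (i - 1) - bous N i, i)
  out := if i + 1 < N ^ 2 then some (bous N (i + 1) - bous N i, i + 1) else none
  symI := none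
  symO := none
  neg := if i = 0 then some (0, -1) else none

/-- The boustrophedon path through a square, as a path system. -/
def bousSystem (N : ℕ) (hN : 2 ≤ N) : PathSystem ℕ ℕ ℕ where
  V := Finset.range (N ^ 2)
  pos := bous N
  td := bousTD N
  s0 := 0
  s0_mem := Finset.mem_range.2 (by positivity)
  s0_inp := rfl
  pos_inj i _ j _ h := bous_inj (by omega) h
  wf i hi := by
    have h1 := bous_succ (N := N) (by omega) i
    rcases i with - | i
    · have h2 : 1 < N ^ 2 := Nat.one_lt_pow two_ne_zero hN
      rcases h1 with ⟨h1, -⟩ | ⟨h1, -⟩ | ⟨h1, -⟩ <;> simp only [zero_add] at h1 <;>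
        simp [TD.WF, TD.sides, bousTD, h1, h2, U2]
    · have h2 := bous_succ (N := N) (by omega) i
      have h3 := div_mod_succ (N := N) (by omega) i
      rw [← neg_sub, neg_eq_iff_eq_neg, neg_eq_iff_eq_neg, neg_eq_iff_eq_neg] at h2
      by_cases hi : i + 1 + 1 < N ^ 2
      · rcases h1 with ⟨h1, h0⟩ | ⟨h1, h0⟩ | ⟨h1, h0⟩ <;>
          rcases h2 with ⟨h2, h0'⟩ | ⟨h2, h0'⟩ | ⟨h2, h0'⟩ <;>
          simp [TD.WF, TD.sides, bousTD, h1, h2, hi, U2] <;>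
          generalize i / N = q at * <;> generalize i % N = r at * <;>
          generalize (i + 1) / N = q' at * <;> generalize (i + 1) % N = r' at * <;> omega
      · rcases h2 with ⟨h2, h0'⟩ | ⟨h2, h0'⟩ | ⟨h2, h0'⟩ <;>
          simp [TD.WF, TD.sides, bousTD, h2, hi, U2]
  pred i hi := by
    rcases i with - | i
    · exact Or.inl rfl
    · rw [Finset.mem_range] at hi
      exact Or.inr ⟨i, Finset.mem_range.2 (by omega), ⟨by omega, _, _, (add_sub_cancel _ _).symm,
        by simp [bousTD, hi]; rfl, by simp [bousTD]⟩⟩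
  succ i _ := by
    by_cases hi : i + 1 < N ^ 2
    · exact Or.inr ⟨i + 1, Finset.mem_range.2 hi, ⟨by omega, _, _, (add_sub_cancel _ _).symm,
        by simp [bousTD, hi]; rfl, by simp [bousTD]⟩⟩
    · exact Or.inl (by simp [bousTD, hi])
  det i _ j _ h h' := by
    have : i = j := by
      by_cases hi : i = 0
      · simp [bousTD, hi] at h'
      · by_cases hj : j = 0
        · simp [bousTD, hi, hj] at h
        · simp only [bousTD, hi, hj, if_false, Option.some.injEq, Prod.mk.injEq] at h
          exact h.2
    simp [this]
  guard f _ d s h := by simp [bousTD] at h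
  read c _ w s h := by simp [bousTD] at h
  free g _ w h _ j _ h' := by
    by_cases hg : g = 0
    · subst hg
      simp only [bousTD, if_true, Option.some.injEq] at h
      subst h
      have h2 : ((j / N : ℕ) : ℤ) = ((0 / N : ℕ) : ℤ) + -1 := congrArg Prod.snd h'
      rw [Nat.zero_div] at h2
      generalize j / N = q at h2
      omega
    · simp [bousTD, hg] at h
  has_neg := ⟨0, Finset.mem_range.2 (by positivity), by simp [bousTD]⟩

theorem exists_tas_small {N : ℕ} (hN : 2 ≤ N) : ∃ 𝒯 : TAS, IsRgTAS 𝒯 ∧ DirectedTAS 𝒯 ∧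
    StrictlySelfAssembles 𝒯 (SN N) ∧ 𝒯.tiles.card ≤ N ^ 2 := by
  classical
  obtain ⟨𝒯, h1, h2, h3, h4⟩ := (bousSystem N hN).exists_tas bous_image
  exact ⟨𝒯, h1, h2, h3, h4.trans (Finset.card_image_le.trans (Finset.card_range _).le)⟩


open Real in
theorem logb_two_le {x : ℝ} (hx : 0 < x) : logb 2 x ≤ 2 * x := by
  have h1 : (0.5 : ℝ) < log 2 := lt_trans (by norm_num) log_two_gt_d9
  rw [logb, div_le_iff₀ (by linarith)]
  have := log_le_sub_one_of_pos hx
  nlinarith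

open Real in
theorem le_div_logb {k L : ℝ} (hL : 1 < L) (hk : 0 < k) (h : k * logb 2 k ≤ L) :
    k ≤ 4 * (L / logb 2 L) := by
  have h0 : 0 < logb 2 L := logb_pos one_lt_two hL
  have hs : logb 2 L = 2 * logb 2 (√L) := by
    rw [logb, logb, log_sqrt (by linarith)]; ring
  have hpos : 0 < √L := sqrt_pos.2 (by linarith)
  have hsq : √L * √L = L := mul_self_sqrt (by linarith)
  rw [← mul_div_assoc, le_div_iff₀ h0]
  rcases le_total k (√L) with hkL | hkL
  · have h1 := logb_two_le hpos
    nlinarith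
  · have h1 : logb 2 (√L) ≤ logb 2 k := logb_le_logb_of_le one_lt_two hpos hkL
    nlinarith

theorem exists_par {N : ℕ} (hN : 23 ≤ N) :
    ∃ P : Par, P.N = N ∧ (P.n = 2 ∨ ∃ k, 2 ≤ k ∧ P.n = k + 1 ∧ k ^ k ≤ N) := by
  obtain ⟨m, hm⟩ : ∃ m, m = (N - 11) / 4 := ⟨_, rfl⟩
  have hN' : 4 * m + 11 + (N - 11) % 4 = N := by omega
  have hex : ∃ n, 2 ≤ n ∧ m ≤ n ^ n := ⟨m + 2, by omega, by
    calc m ≤ (m + 2) ^ 1 := by rw [pow_one]; omega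
      _ ≤ (m + 2) ^ (m + 2) := Nat.pow_le_pow_right (by omega) (by omega)⟩
  classical
  obtain ⟨n, ⟨hn, hp⟩, hmin⟩ : ∃ n, (2 ≤ n ∧ m ≤ n ^ n) ∧ ∀ k < n, ¬ (2 ≤ k ∧ m ≤ k ^ k) :=
    ⟨Nat.find hex, Nat.find_spec hex, fun k hk => Nat.find_min hex hk⟩
  have key : n < m ∧ (n = 2 ∨ ∃ k, 2 ≤ k ∧ n = k + 1 ∧ k ^ k ≤ N) := by
    rcases hn.eq_or_lt with rfl | hn
    · exact ⟨by omega, Or.inl rfl⟩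
    · obtain ⟨k, rfl⟩ : ∃ k, n = k + 1 := ⟨n - 1, by omega⟩
      have h1 : k ^ k < m := not_le.1 fun h => hmin k (Nat.lt_succ_self k) ⟨by omega, h⟩
      have h2 : k ^ 2 ≤ k ^ k := Nat.pow_le_pow_right (by omega) (by omega)
      have h3 : k + 2 ≤ k ^ 2 := by nlinarith
      exact ⟨by omega, Or.inr ⟨k, by omega, rfl, by omega⟩⟩
  exact ⟨⟨n, m, m + 1 - n, (N - 11) % 4, hn, by omega, by omega, by omega, hp⟩,
    hN', key.2⟩

open Real in
theorem exists_par_le {N : ℕ} (hN : 23 ≤ N) :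
    ∃ P : Par, P.N = N ∧ (P.n : ℝ) ≤ 8 * (logb 2 N / logb 2 (logb 2 N)) := by
  have hL : 1 < logb 2 (N : ℝ) := by
    rw [lt_logb_iff_rpow_lt one_lt_two (by positivity), rpow_one]
    exact_mod_cast (by omega : 2 < N)
  obtain ⟨P, hP, h⟩ := exists_par hN
  refine ⟨P, hP, ?_⟩
  rcases h with h | ⟨k, hk, hn, h⟩
  · have := le_div_logb hL one_pos (by simp; linarith)
    rw [h]
    push_cast
    linarith
  · have hk0 : (0 : ℝ) < k := by exact_mod_cast (by omega : 0 < k)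
    have := le_div_logb hL hk0 (by
      rw [← logb_pow]
      exact logb_le_logb_of_le one_lt_two (by positivity) (by exact_mod_cast h))
    have h1 : (P.n : ℝ) ≤ 2 * k := by exact_mod_cast (by omega : P.n ≤ 2 * k)
    linarith

end TA

open TA Real in
/-- There is a constant `C > 0` such that for every `N ≥ 5` there is a directed
rgTAS in which the `N × N` square strictly self-assembles using at most
`C · log₂ N / log₂ log₂ N` tile types. -/
theorem rgTAS_square_optimal :
    ∃ C : ℝ, 0 < C ∧ ∀ N : ℕ, 5 ≤ N →
      ∃ 𝒯 : TAS, IsRgTAS 𝒯 ∧ DirectedTAS 𝒯 ∧ StrictlySelfAssembles 𝒯 (SN N) ∧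
        (𝒯.tiles.card : ℝ) ≤ C * (logb 2 N / logb 2 (logb 2 N)) := by
  refine ⟨109872, by norm_num, fun N hN => ?_⟩
  by_cases h : 23 ≤ N
  · obtain ⟨P, rfl, hP⟩ := exists_par_le h
    obtain ⟨𝒯, h1, h2, h3, h4⟩ := P.exists_tas
    refine ⟨𝒯, h1, h2, h3, ?_⟩
    have h5 : (𝒯.tiles.card : ℝ) ≤ 13734 * P.n := by exact_mod_cast h4
    linarith
  · obtain ⟨𝒯, h1, h2, h3, h4⟩ := exists_tas_small (N := N) (by omega)
    refine ⟨𝒯, h1, h2, h3, ?_⟩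
    have h5 : (𝒯.tiles.card : ℝ) ≤ 22 ^ 2 := by
      exact_mod_cast h4.trans (Nat.pow_le_pow_left (by omega) 2)
    have hL : 1 < logb 2 (N : ℝ) := by
      rw [lt_logb_iff_rpow_lt one_lt_two (by positivity), rpow_one]
      exact_mod_cast (by omega : 2 < N)
    have := le_div_logb hL one_pos (by simp; linarith)
    linarith
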